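/- Let p be a prime. For every finite group G, the set {x ∈ G : for every y ∈ G, the subgroup ⟨x,y⟩ belongs to 𝔖_p𝔑} equals (as a set) the intersection of all 𝔖_p𝔑-maximal subgroups of G (i.e. the class 𝔖_p𝔑 is regular). -/

import Mathlib

universe u

/-- The factor group `B / A` is nilpotent, for subgroups `A ≤ B` of an ambient group
with `A` normal in the ambient group. -/
def NilpotentFactor {X : Type u} [Group X] (A B : Subgroup X) (hA : A.Normal) : Prop :=
  letI : (A.subgroupOf B).Normal := hA.subgroupOf B
  Group.IsNilpotent (↥B ⧸ A.subgroupOf B)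

/-- `X` has Fitting length at most `t`: there is a chain `1 = X₀ ≤ X₁ ≤ … ≤ X_t = X`
of subgroups, each normal in `X`, with all factors `X_i / X_{i-1}` nilpotent. -/
def FittingLengthLE (X : Type u) [Group X] (t : ℕ) : Prop :=
  ∃ (H : Fin (t + 1) → Subgroup X) (hnorm : ∀ i, (H i).Normal),
    H 0 = ⊥ ∧ H (Fin.last t) = ⊤ ∧ (∀ i : Fin t, H i.castSucc ≤ H i.succ) ∧
    ∀ i : Fin t, NilpotentFactor (H i.castSucc) (H i.succ) (hnorm i.castSucc)

/-- `X ∈ 𝔖_p𝔑ᵗ`: `X` has a normal `p`-subgroup `N` such that `X / N` has Fitting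
length at most `t`. -/
def SpNt (p t : ℕ) (X : Type u) [Group X] : Prop :=
  ∃ (N : Subgroup X) (hN : N.Normal), IsPGroup p ↥N ∧
    (letI := hN; FittingLengthLE (X ⧸ N) t)



set_option linter.unusedSectionVars false
set_option linter.style.haveILetI false

def PEl {G : Type u} [Group G] (p : ℕ) (z : G) : Prop := ∃ n : ℕ, z ^ p ^ n = 1

def PS {G : Type u} [Group G] (p : ℕ) (H : Subgroup G) : Prop := ∀ g ∈ H, PEl p g

def FF (p : ℕ) (X : Type u) [Group X] : Prop :=
  ∃ (N : Subgroup X) (_ : N.Normal), IsPGroup p ↥N ∧ Group.IsNilpotent (X ⧸ N)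

abbrev Nm {G : Type u} [Group G] (D : Subgroup G) : Subgroup G := Subgroup.normalizer (D : Set G)

def cj {G : Type u} [Group G] (k : G) (S : Subgroup G) : Subgroup G :=
  S.comap (MulAut.conj k⁻¹).toMonoidHom

def MaxP {G : Type u} [Group G] (p : ℕ) (K S : Subgroup G) : Prop :=
  S ≤ K ∧ PS p S ∧ ∀ Q : Subgroup G, Q ≤ K → PS p Q → S ≤ Q → Q ≤ S

section
variable {G : Type u} [Group G]

theorem mem_cj {k g : G} {S : Subgroup G} : g ∈ cj k S ↔ k⁻¹ * g * k ∈ S := by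
  simp [cj, Subgroup.mem_comap]

theorem ps_iff {p : ℕ} {H : Subgroup G} : PS p H ↔ IsPGroup p H := by
  constructor
  · intro h ⟨g, hg⟩
    obtain ⟨n, hn⟩ := h g hg
    exact ⟨n, by ext; simpa using hn⟩
  · intro h g hg
    obtain ⟨n, hn⟩ := h ⟨g, hg⟩
    exact ⟨n, by simpa using congrArg Subtype.val hn⟩

theorem PS.mono {p : ℕ} {H K : Subgroup G} (h : PS p H) (hk : K ≤ H) : PS p K :=
  fun g hg => h g (hk hg)

theorem ps_bot {p : ℕ} : PS p (⊥ : Subgroup G) := by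
  intro g hg
  exact ⟨0, by simp [Subgroup.mem_bot.1 hg]⟩

theorem PEl.conj {p : ℕ} {z : G} (h : PEl p z) (g : G) : PEl p (g * z * g⁻¹) := by
  obtain ⟨n, hn⟩ := h
  exact ⟨n, by rw [conj_pow, hn]; simp⟩

theorem PEl.conj' {p : ℕ} {z : G} (h : PEl p z) (g : G) : PEl p (g⁻¹ * z * g) := by
  simpa using h.conj g⁻¹

theorem PEl.inv {p : ℕ} {z : G} (h : PEl p z) : PEl p z⁻¹ := by
  obtain ⟨n, hn⟩ := h
  exact ⟨n, by rw [inv_pow, hn]; simp⟩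

theorem PEl.pow {p : ℕ} {z : G} (h : PEl p z) (k : ℕ) : PEl p (z ^ k) := by
  obtain ⟨n, hn⟩ := h
  exact ⟨n, by rw [← pow_mul, mul_comm, pow_mul, hn, one_pow]⟩

theorem pel_one {p : ℕ} : PEl p (1 : G) := ⟨0, by simp⟩

theorem PEl.map {p : ℕ} {G' : Type*} [Group G'] (f : G →* G') {z : G} (h : PEl p z) :
    ∃ n : ℕ, (f z) ^ p ^ n = 1 := by
  obtain ⟨n, hn⟩ := h
  exact ⟨n, by rw [← map_pow, hn, map_one]⟩

theorem PEl.zpowers {p : ℕ} {z : G} (h : PEl p z) : PS p (Subgroup.zpowers z) := by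
  rintro g ⟨k, rfl⟩
  obtain ⟨n, hn⟩ := h
  refine ⟨n, ?_⟩
  simp only
  rw [← zpow_natCast, ← zpow_mul, mul_comm, zpow_mul, zpow_natCast, hn, one_zpow]

theorem PS.cj {p : ℕ} {S : Subgroup G} (h : PS p S) (k : G) : PS p (cj k S) := by
  intro g hg
  have := (h _ (mem_cj.1 hg)).conj k
  simpa [mul_assoc] using this

theorem pel_coprime {p q : ℕ} (hp : p.Prime) (hq : q.Prime) (hpq : p ≠ q) {z : G}
    (h1 : PEl p z) (h2 : PEl q z) : z = 1 := by
  obtain ⟨n, hn⟩ := h1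
  obtain ⟨m, hm⟩ := h2
  have h1 := orderOf_dvd_of_pow_eq_one hn
  have h2 := orderOf_dvd_of_pow_eq_one hm
  have hc : Nat.Coprime (p ^ n) (q ^ m) := Nat.Coprime.pow _ _ ((Nat.coprime_primes hp hq).2 hpq)
  exact orderOf_eq_one_iff.1 (Nat.eq_one_of_dvd_coprimes hc h1 h2)

theorem mem_Nm {x : G} {D : Subgroup G} : x ∈ Nm D ↔ ∀ d, d ∈ D ↔ x * d * x⁻¹ ∈ D :=
  Subgroup.mem_normalizer_iff

theorem Nm.conj {x : G} {D : Subgroup G} (h : x ∈ Nm D) {d : G} (hd : d ∈ D) : x * d * x⁻¹ ∈ D :=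
  (mem_Nm.1 h d).1 hd

theorem Nm.conj' {x : G} {D : Subgroup G} (h : x ∈ Nm D) {d : G} (hd : d ∈ D) : x⁻¹ * d * x ∈ D := by
  simpa using Nm.conj (inv_mem h) hd

theorem le_Nm {D : Subgroup G} : D ≤ Nm D := Subgroup.le_normalizer

theorem nm_of [Finite G] {x : G} {D : Subgroup G} (h : ∀ d ∈ D, x * d * x⁻¹ ∈ D) : x ∈ Nm D :=
  Subgroup.mem_normalizer_fintype h

/-- commutator with x in D and x∈ ... -/
theorem nm_of_comm [Finite G] {x : G} {D : Subgroup G} (h : ∀ d ∈ D, x * d * x⁻¹ * d⁻¹ ∈ D) : x ∈ Nm D :=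
  nm_of fun d hd => by simpa using mul_mem (h d hd) hd

theorem mem_cj_self {k g : G} {S : Subgroup G} (h : g ∈ S) : k * g * k⁻¹ ∈ cj k S := by
  rw [mem_cj]; simpa [mul_assoc] using h

theorem ps_sup {p : ℕ} {A B : Subgroup G} (hA : PS p A) (hB : PS p B) (h : A ≤ Nm B) : PS p (A ⊔ B) :=
  ps_iff.2 (IsPGroup.to_sup_of_normal_right' (ps_iff.1 hA) (ps_iff.1 hB) h)

theorem normal_of_Nm {D : Subgroup G} (h : ∀ g, g ∈ Nm D) : D.Normal :=
  Subgroup.normalizer_eq_top_iff.1 (by ext; simp [h])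

theorem nm_sup {x : G} {A B : Subgroup G} (hA : x ∈ Nm A) (hB : x ∈ Nm B) : x ∈ Nm (A ⊔ B) := by
  have key : ∀ y : G, y ∈ Nm A → y ∈ Nm B → ∀ d ∈ A ⊔ B, y * d * y⁻¹ ∈ A ⊔ B := by
    intro y hA hB
    have : A ⊔ B ≤ (A ⊔ B).comap (MulAut.conj y).toMonoidHom := by
      apply sup_le
      · intro a ha
        exact Subgroup.mem_sup_left (by simpa using Nm.conj hA ha)
      · intro a ha
        exact Subgroup.mem_sup_right (by simpa using Nm.conj hB ha)
    intro d hd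
    simpa using this hd
  rw [mem_Nm]
  intro d
  refine ⟨key x hA hB d, fun h => ?_⟩
  simpa [mul_assoc] using key x⁻¹ (inv_mem hA) (inv_mem hB) _ h

theorem nm_inf {x : G} {A B : Subgroup G} (hA : x ∈ Nm A) (hB : x ∈ Nm B) : x ∈ Nm (A ⊓ B) := by
  rw [mem_Nm] at *
  intro d
  rw [Subgroup.mem_inf, Subgroup.mem_inf, hA d, hB d]

theorem nm_closure {x : G} {s : Set G} (h : ∀ a ∈ s, x * a * x⁻¹ ∈ s) [Finite G] :
    x ∈ Nm (Subgroup.closure s) := by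
  apply nm_of
  have : Subgroup.closure s ≤ (Subgroup.closure s).comap (MulAut.conj x).toMonoidHom := by
    rw [Subgroup.closure_le]
    intro a ha
    exact Subgroup.subset_closure (by simpa using h a ha)
  intro d hd
  simpa using this hd

theorem mem_sup_nm {A B : Subgroup G} (h : A ≤ Nm B) {g : G} : g ∈ A ⊔ B ↔ ∃ a ∈ A, ∃ b ∈ B, a * b = g := by
  rw [← SetLike.mem_coe, Subgroup.coe_mul_of_left_le_normalizer_right A B h, Set.mem_mul]
  rfl

end


section
variable {G : Type u} [Group G] [Finite G]

theorem exMax (P : Subgroup G → Prop) {D : Subgroup G} (hD : P D) :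
    ∃ S, D ≤ S ∧ P S ∧ ∀ Q, P Q → S ≤ Q → Q ≤ S := by
  obtain ⟨m, h1, h2⟩ := (Set.toFinite {S | P S}).exists_le_maximal hD
  exact ⟨m, h1, h2.1, fun Q hQ h => h2.2 hQ h⟩

theorem exMaxP {p : ℕ} {K D : Subgroup G} (hDK : D ≤ K) (hD : PS p D) :
    ∃ S, MaxP p K S ∧ D ≤ S := by
  obtain ⟨S, h1, h2, h3⟩ := exMax (fun S => S ≤ K ∧ PS p S) ⟨hDK, hD⟩
  exact ⟨S, ⟨h2.1, h2.2, fun Q a b c => h3 Q ⟨a, b⟩ c⟩, h1⟩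

theorem MaxP.mem {p : ℕ} {K S : Subgroup G} (hS : MaxP p K S) {z : G} (hz : PEl p z) (hzK : z ∈ K)
    (hn : z ∈ Nm S) : z ∈ S := by
  have h := ps_sup hz.zpowers hS.2.1 (by simpa [Subgroup.zpowers_le] using hn)
  refine hS.2.2 _ (sup_le (by simpa using hzK) hS.1) h le_sup_right
    (Subgroup.mem_sup_left (Subgroup.mem_zpowers z))

theorem MaxP.le {p : ℕ} {K S D : Subgroup G} (hS : MaxP p K S) (hD : PS p D) (hDK : D ≤ K)
    (hn : D ≤ Nm S) : D ≤ S := fun d hd => hS.mem (hD d hd) (hDK hd) (hn hd)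

/-- A normalized p-subgroup is contained in every maximal p-subgroup. -/
theorem MaxP.le' {p : ℕ} {K S D : Subgroup G} (hS : MaxP p K S) (hD : PS p D) (hDK : D ≤ K)
    (hn : S ≤ Nm D) : D ≤ S := by
  have h := ps_sup hS.2.1 hD hn
  exact le_sup_right.trans (hS.2.2 _ (sup_le hS.1 hDK) h le_sup_left)

theorem MaxP.exSylow {p : ℕ} {K S : Subgroup G} (hS : MaxP p K S) :
    ∃ P : Sylow p K, (P : Subgroup K) = S.subgroupOf K := by
  refine ⟨⟨S.subgroupOf K, ?_, ?_⟩, rfl⟩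
  · rw [← ps_iff]
    intro g hg
    obtain ⟨n, hn⟩ := hS.2.1 g hg
    exact ⟨n, by ext; simpa using hn⟩
  · intro Q hQ hle
    have h1 : PS p (Q.map K.subtype) := ps_iff.2 (hQ.map _)
    have h2 : S ≤ Q.map K.subtype := by
      intro s hs
      exact ⟨⟨s, hS.1 hs⟩, hle (by simpa [Subgroup.mem_subgroupOf] using hs), rfl⟩
    have h3 := hS.2.2 _ (Subgroup.map_subtype_le Q) h1 h2
    apply le_antisymm _ hle
    intro g hg
    exact h3 ⟨g, hg, rfl⟩

theorem MaxP.conj {p : ℕ} (hp : p.Prime) {K S S' : Subgroup G} (hS : MaxP p K S) (hS' : MaxP p K S') :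
    ∃ k ∈ K, ∀ g, g ∈ S' ↔ k⁻¹ * g * k ∈ S := by
  have := Fact.mk hp
  obtain ⟨P, hP⟩ := hS.exSylow
  obtain ⟨P', hP'⟩ := hS'.exSylow
  obtain ⟨k, hk⟩ := MulAction.exists_smul_eq K P P'
  refine ⟨k, k.2, fun g => ?_⟩
  have key : ∀ g : K, g ∈ (P' : Subgroup K) ↔ k⁻¹ * g * k ∈ (P : Subgroup K) := by
    intro g
    rw [← hk, Sylow.coe_subgroup_smul, Subgroup.mem_pointwise_smul_iff_inv_smul_mem]
    simp [MulAut.smul_def]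
  rw [hP, hP'] at key
  constructor
  · intro h
    have := (key ⟨g, hS'.1 h⟩).1 (by simpa [Subgroup.mem_subgroupOf] using h)
    simpa [Subgroup.mem_subgroupOf] using this
  · intro h
    have hg : g ∈ K := by
      have h1 := mul_mem (mul_mem k.2 (hS.1 h)) (inv_mem k.2)
      simpa [mul_assoc] using h1
    have := (key ⟨g, hg⟩).2 (by simpa [Subgroup.mem_subgroupOf] using h)
    simpa [Subgroup.mem_subgroupOf] using this

theorem grow {r : ℕ} (hr : r.Prime) {R E : Subgroup G} (hR : PS r R) (h : E ≤ R) (h' : ¬ R ≤ E) :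
    ∃ y ∈ R, y ∉ E ∧ y ∈ Nm E := by
  have := Fact.mk hr
  have : Group.IsNilpotent R := (ps_iff.1 hR).isNilpotent
  have hc := Group.normalizerCondition_of_isNilpotent (G := R)
  have hlt : E.subgroupOf R < ⊤ := by
    rw [lt_top_iff_ne_top]
    intro he
    exact h' (Subgroup.subgroupOf_eq_top.1 he)
  obtain ⟨y, hy1, hy2⟩ := SetLike.exists_of_lt (hc _ hlt)
  refine ⟨y, y.2, fun h => hy2 (by simpa [Subgroup.mem_subgroupOf] using h), ?_⟩
  rw [Subgroup.mem_normalizer_iff] at hy1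
  apply nm_of
  intro d hd
  have := (hy1 ⟨d, h hd⟩).1 (by simpa [Subgroup.mem_subgroupOf] using hd)
  simpa [Subgroup.mem_subgroupOf] using this

theorem cop {p q : ℕ} (hp : p.Prime) (hq : q.Prime) (hpq : p ≠ q) {x : G} (hx : PEl q x)
    {J : Subgroup G} (hJ : PS p J) (hn : x ∈ Nm J) {v : G} (hv : v⁻¹ * (x * v * x⁻¹) ∈ J) :
    ∃ c, Commute x c ∧ ∃ j ∈ J, v = c * j := by
  classical
  have := Fact.mk hp
  have := Fact.mk hq
  haveI := Fintype.ofFinite J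
  let f : J → J := fun j => ⟨v⁻¹ * x * v * j * x⁻¹, by
    have := mul_mem hv (Nm.conj hn j.2)
    simpa [mul_assoc] using this⟩
  have hf : Function.Injective f := by
    intro a b hab
    have := congrArg Subtype.val hab
    ext
    simpa [f] using this
  let σ : Equiv.Perm J := Equiv.ofBijective f (Finite.injective_iff_bijective.1 hf)
  have hσ : ∀ k : ℕ, ∀ j : J, (((σ ^ k) j : J) : G) = v⁻¹ * x ^ k * v * j * (x ^ k)⁻¹ := by
    intro k
    induction k with
    | zero => intro j; simp
    | succ k ih =>
      intro j
      rw [pow_succ', Equiv.Perm.mul_apply]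
      change v⁻¹ * x * v * _ * x⁻¹ = _
      rw [ih, pow_succ']
      group
  obtain ⟨n, hn'⟩ := hx
  have h1 : σ ^ q ^ n = 1 := by
    ext j
    rw [hσ, hn']; simp
  have hcard : ¬ q ∣ Fintype.card J := by
    obtain ⟨m, hm⟩ := IsPGroup.iff_card.1 (ps_iff.1 hJ)
    rw [← Nat.card_eq_fintype_card, hm]
    intro h
    exact hpq ((Nat.prime_dvd_prime_iff_eq hq hp).1 (hq.dvd_of_dvd_pow h)).symm
  obtain ⟨j, hj⟩ := Equiv.Perm.exists_fixed_point_of_prime hcard h1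
  have hj' : v⁻¹ * x * v * j * x⁻¹ = (j : G) := congrArg Subtype.val hj
  refine ⟨v * j, ?_, j⁻¹, inv_mem j.2, by simp⟩
  change x * (v * j) = v * j * x
  calc x * (v * j) = v * (v⁻¹ * x * v * j * x⁻¹) * x := by group
    _ = _ := by rw [hj']

theorem surj {x : G} {S : Subgroup G} (hn : x ∈ Nm S) (h : ∀ c ∈ S, Commute x c → c = 1) :
    ∀ m ∈ S, ∃ n ∈ S, x * m = n * x * n⁻¹ := by
  let f : S → S := fun n => ⟨x⁻¹ * n * x * (n : G)⁻¹, mul_mem (Nm.conj' hn n.2) (inv_mem n.2)⟩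
  have hf : Function.Injective f := by
    intro a b hab
    have h1 : x⁻¹ * a * x * (a : G)⁻¹ = x⁻¹ * b * x * (b : G)⁻¹ := congrArg Subtype.val hab
    have h2 : Commute x ((b : G)⁻¹ * a) := by
      change x * ((b : G)⁻¹ * a) = (b : G)⁻¹ * a * x
      have : (a:G) * x = b * x * (b : G)⁻¹ * a := by
        have := congrArg (fun t => x * t * a) h1
        simpa [mul_assoc] using this
      rw [mul_assoc _ (a : G) x, this]; group
    have h3 := h _ (mul_mem (inv_mem b.2) a.2) h2
    ext
    exact (inv_mul_eq_one.1 h3).symm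
  intro m hm
  obtain ⟨n, hn⟩ := (Finite.injective_iff_surjective.1 hf) ⟨m, hm⟩
  have h1 : x⁻¹ * n * x * (n : G)⁻¹ = m := congrArg Subtype.val hn
  exact ⟨n, n.2, by rw [← h1]; group⟩

/-- every p-element lying in all Sylow subgroups lies in a normal p-subgroup -/
theorem core {p : ℕ} (z : G) (h : ∀ P, MaxP p ⊤ P → z ∈ P) :
    ∃ N : Subgroup G, N.Normal ∧ PS p N ∧ z ∈ N := by
  obtain ⟨P, hP, -⟩ := exMaxP (p := p) (K := ⊤) (D := (⊥ : Subgroup G)) le_top ps_bot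
  refine ⟨P.normalCore, inferInstance, hP.2.1.mono P.normalCore_le, ?_⟩
  intro b
  have h2 : MaxP p ⊤ (cj b⁻¹ P) := by
    refine ⟨le_top, hP.2.1.cj _, fun Q _ hQ hle => ?_⟩
    have h3 := hP.2.2 (cj b Q) le_top (hQ.cj _) (by
      intro g hg
      rw [mem_cj]
      apply hle
      rw [mem_cj]
      simpa [mul_assoc] using hg)
    intro g hg
    rw [mem_cj]
    apply h3
    rw [mem_cj]
    simpa [mul_assoc] using hg
  have := h _ h2
  rw [mem_cj] at this
  simpa using this

theorem MaxP.cjTop {p : ℕ} {P : Subgroup G} (hP : MaxP p ⊤ P) (b : G) : MaxP p ⊤ (cj b P) := by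
  refine ⟨le_top, hP.2.1.cj _, fun Q _ hQ hle => ?_⟩
  have h3 := hP.2.2 (cj b⁻¹ Q) le_top (hQ.cj _) (by
    intro g hg
    rw [mem_cj]
    apply hle
    rw [mem_cj]
    simpa [mul_assoc] using hg)
  intro g hg
  rw [mem_cj]
  apply h3
  rw [mem_cj]
  simpa [mul_assoc] using hg

end


section
variable {G : Type u} [Group G] [Finite G]

theorem bsA {p : ℕ} (hp : p.Prime) {T : Set G} (hT : ∀ t ∈ T, ∀ g, g * t * g⁻¹ ∈ T)
    {P Q : Subgroup G} (hP : PS p P) {t : G} (ht : t ∈ T) (htP : t ∈ P) (htQ : t ∉ Q) :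
    ∃ a ∈ T, a ∈ P ∧ a ∉ Q ∧ a ∈ Nm (Subgroup.closure {s | s ∈ T ∧ s ∈ P ∧ s ∈ Q}) := by
  set D := Subgroup.closure {s | s ∈ T ∧ s ∈ P ∧ s ∈ Q} with hD
  have hDP : D ≤ P := (Subgroup.closure_le _).2 fun s hs => hs.2.1
  have hDQ : D ≤ Q := (Subgroup.closure_le _).2 fun s hs => hs.2.2
  obtain ⟨E, hDE, ⟨hEP, hEQ⟩, hmax⟩ := exMax (fun E => E ≤ P ∧ ∀ s ∈ T, s ∈ E → s ∈ Q)
    (D := D) ⟨hDP, fun s _ h => hDQ h⟩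
  obtain ⟨y, hyP, hyE, hyN⟩ := grow hp hP hEP (fun h => htQ (hEQ t ht (h htP)))
  have hE' : ¬ ∀ s ∈ T, s ∈ E ⊔ Subgroup.zpowers y → s ∈ Q := by
    intro h
    have := hmax (E ⊔ Subgroup.zpowers y) ⟨sup_le hEP (by simpa using hyP), h⟩ le_sup_left
    exact hyE (this (Subgroup.mem_sup_right (Subgroup.mem_zpowers y)))
  push Not at hE'
  obtain ⟨a, haT, haE, haQ⟩ := hE'
  have haP : a ∈ P := (sup_le hEP (by simpa using hyP) : E ⊔ Subgroup.zpowers y ≤ P) haE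
  have haN : a ∈ Nm E := (sup_le le_Nm (by simpa using hyN) : E ⊔ Subgroup.zpowers y ≤ Nm E) haE
  refine ⟨a, haT, haP, haQ, ?_⟩
  apply nm_closure
  rintro s ⟨h1, h2, h3⟩
  have hsE : s ∈ E := hDE (Subgroup.subset_closure ⟨h1, h2, h3⟩)
  have h4 := Nm.conj haN hsE
  exact ⟨hT _ h1 _, hEP h4, hEQ _ (hT _ h1 _) h4⟩

theorem bsCard {p : ℕ} (hp : p.Prime) {T : Set G} (hT : ∀ t ∈ T, ∀ g, g * t * g⁻¹ ∈ T)
    {P Q : Subgroup G} (hP : MaxP p ⊤ P) (hQ : MaxP p ⊤ Q) (h : ∀ t ∈ T, t ∈ P → t ∈ Q) :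
    ∀ t ∈ T, t ∈ Q → t ∈ P := by
  obtain ⟨k, -, hk⟩ := hQ.conj hp hP
  -- conj by k⁻¹ maps T ∩ P into T ∩ Q
  let f : {t // t ∈ T ∧ t ∈ Q} → {t // t ∈ T ∧ t ∈ P} := fun t => ⟨k * t * k⁻¹, hT _ t.2.1 _, by
    rw [hk]; simpa [mul_assoc] using t.2.2⟩
  let g : {t // t ∈ T ∧ t ∈ P} → {t // t ∈ T ∧ t ∈ Q} := fun t => ⟨t, t.2.1, h t t.2.1 t.2.2⟩
  have hf : Function.Injective f := by
    intro a b hab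
    have := congrArg Subtype.val hab
    ext
    simpa [f] using this
  have hg : Function.Injective g := by
    intro a b hab
    have := congrArg Subtype.val hab
    ext
    simpa [g] using this
  have hgf : Function.Surjective (g ∘ f) := Finite.injective_iff_surjective.1 (hg.comp hf)
  intro t ht htQ
  obtain ⟨s, hs⟩ := hgf ⟨t, ht, htQ⟩
  have : ((f s : {t // t ∈ T ∧ t ∈ P}) : G) = t := congrArg Subtype.val hs
  rw [← this]
  exact (f s).2.2

theorem bs {p : ℕ} (hp : p.Prime) {T : Set G} (hT : ∀ t ∈ T, ∀ g, g * t * g⁻¹ ∈ T)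
    (hab : ∀ a ∈ T, ∀ b ∈ T, PS p (Subgroup.closure {a, b})) :
    ∀ P, MaxP p ⊤ P → ∀ t ∈ T, t ∈ P := by
  by_contra hcon
  push Not at hcon
  obtain ⟨Q0, hQ0, t0, ht0, htQ0⟩ := hcon
  let bad : Set (Subgroup G × Subgroup G) :=
    {PQ | MaxP p ⊤ PQ.1 ∧ MaxP p ⊤ PQ.2 ∧ ∃ t ∈ T, t ∈ PQ.1 ∧ t ∉ PQ.2}
  have hne : bad.Nonempty := by
    have hpe : PEl p t0 := hab t0 ht0 t0 ht0 t0 (Subgroup.subset_closure (by simp))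
    obtain ⟨P0, hP0, hle⟩ := exMaxP (K := ⊤) le_top hpe.zpowers
    exact ⟨(P0, Q0), hP0, hQ0, t0, ht0, hle (Subgroup.mem_zpowers _), htQ0⟩
  obtain ⟨⟨P, Q⟩, ⟨hP, hQ, t, ht, htP, htQ⟩, hmax⟩ := Set.exists_max_image bad
    (fun PQ => ({s | s ∈ T ∧ s ∈ PQ.1 ∧ s ∈ PQ.2} : Set G).ncard) (Set.toFinite _) hne
  dsimp only at hP hQ htP htQ hmax
  have hQP : ∃ t' ∈ T, t' ∈ Q ∧ t' ∉ P := by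
    by_contra hc
    push Not at hc
    exact htQ (bsCard hp hT hQ hP hc t ht htP)
  obtain ⟨t', ht', htQ', htP'⟩ := hQP
  obtain ⟨a, haT, haP, haQ, haN⟩ := bsA hp hT hP.2.1 ht htP htQ
  obtain ⟨b, hbT, hbQ, hbP, hbN⟩ := bsA hp hT hQ.2.1 ht' htQ' htP'
  have hset : {s | s ∈ T ∧ s ∈ Q ∧ s ∈ P} = {s | s ∈ T ∧ s ∈ P ∧ s ∈ Q} := by
    ext s; simp only [Set.mem_ofPred_eq]; tauto
  rw [hset] at hbN
  set D := Subgroup.closure {s | s ∈ T ∧ s ∈ P ∧ s ∈ Q} with hD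
  have hDP : D ≤ P := (Subgroup.closure_le _).2 fun s hs => hs.2.1
  have hW : Subgroup.closure {a, b} ≤ Nm D := (Subgroup.closure_le _).2 (by
    rintro s (rfl | rfl)
    · exact haN
    · exact hbN)
  obtain ⟨R, hR, hle⟩ := exMaxP (K := ⊤) le_top (ps_sup (hab a haT b hbT) (hP.2.1.mono hDP) hW)
  have haR : a ∈ R := hle (Subgroup.mem_sup_left (Subgroup.subset_closure (by simp)))
  have hbR : b ∈ R := hle (Subgroup.mem_sup_left (Subgroup.subset_closure (by simp)))
  have hDR : ∀ s, s ∈ T → s ∈ P → s ∈ Q → s ∈ R := fun s h1 h2 h3 =>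
    hle (Subgroup.mem_sup_right (Subgroup.subset_closure ⟨h1, h2, h3⟩))
  have hPR : ∀ s ∈ T, s ∈ P → s ∈ R := by
    by_contra hc
    push Not at hc
    have h1 := hmax (P, R) ⟨hP, hR, hc⟩
    have h2 : ({s | s ∈ T ∧ s ∈ P ∧ s ∈ Q} : Set G).ncard < ({s | s ∈ T ∧ s ∈ P ∧ s ∈ R} : Set G).ncard := by
      apply Set.ncard_lt_ncard _ (Set.toFinite _)
      refine ⟨fun s hs => ⟨hs.1, hs.2.1, hDR s hs.1 hs.2.1 hs.2.2⟩, fun h => ?_⟩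
      exact haQ (h (⟨haT, haP, haR⟩ : a ∈ {s | s ∈ T ∧ s ∈ P ∧ s ∈ R})).2.2
    exact absurd h1 (not_le.2 h2)
  have hQR : ∀ s ∈ T, s ∈ Q → s ∈ R := by
    by_contra hc
    push Not at hc
    have h1 := hmax (Q, R) ⟨hQ, hR, hc⟩
    have h2 : ({s | s ∈ T ∧ s ∈ P ∧ s ∈ Q} : Set G).ncard < ({s | s ∈ T ∧ s ∈ Q ∧ s ∈ R} : Set G).ncard := by
      apply Set.ncard_lt_ncard _ (Set.toFinite _)
      refine ⟨fun s hs => ⟨hs.1, hs.2.2, hDR s hs.1 hs.2.1 hs.2.2⟩, fun h => ?_⟩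
      exact hbP (h (⟨hbT, hbQ, hbR⟩ : b ∈ {s | s ∈ T ∧ s ∈ Q ∧ s ∈ R})).2.1
    exact absurd h1 (not_le.2 h2)
  exact haQ (bsCard hp hT hQ hR hQR a haT haR)

/-- Baer-Suzuki consequence -/
theorem bsN {p : ℕ} (hp : p.Prime) (x : G) (h : ∀ g, PS p (Subgroup.closure {x, g * x * g⁻¹})) :
    ∃ N : Subgroup G, N.Normal ∧ PS p N ∧ x ∈ N := by
  apply core
  intro P hP
  refine bs hp (T := {t | ∃ g, t = g * x * g⁻¹}) ?_ ?_ P hP x ⟨1, by simp⟩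
  · rintro t ⟨g, rfl⟩ k
    exact ⟨k * g, by group⟩
  · rintro a ⟨g, rfl⟩ b ⟨k, rfl⟩
    have h1 := (h (g⁻¹ * k)).cj g
    refine h1.mono ?_
    rw [Subgroup.closure_le]
    rintro s (rfl | rfl)
    · exact mem_cj_self (Subgroup.subset_closure (by simp))
    · rw [SetLike.mem_coe, mem_cj]
      apply Subgroup.subset_closure
      right
      simp only [Set.mem_singleton_iff]; group

/-- elements of a normal r-subgroup of a normal subgroup -/
theorem subnorm {r : ℕ} (hr : r.Prime) {N0 N : Subgroup G} (hN0 : N0.Normal) (hle : N ≤ N0)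
    (hN : PS r N) (hnorm : N0 ≤ Nm N) {a : G} (ha : a ∈ N) :
    ∃ M : Subgroup G, M.Normal ∧ PS r M ∧ a ∈ M := by
  apply bsN hr
  intro g
  have h1 : cj g N ≤ Nm N := by
    intro z hz
    apply hnorm
    have := hN0.conj_mem _ (hle (mem_cj.1 hz)) g
    simpa [mul_assoc] using this
  refine (ps_sup (hN.cj g) hN h1).mono ?_
  rw [Subgroup.closure_le]
  rintro s (rfl | rfl)
  · exact Subgroup.mem_sup_right ha
  · exact Subgroup.mem_sup_left (mem_cj_self ha)

end


theorem nilp_factor {X : Type u} [Group X] (A B : Subgroup X) (hA : A.Normal) (h1 : A = ⊥) (h2 : B = ⊤) :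
    NilpotentFactor A B hA ↔ Group.IsNilpotent X := by
  unfold NilpotentFactor
  subst h1 h2
  let f : X →* (⊤ : Subgroup X) ⧸ (⊥ : Subgroup X).subgroupOf ⊤ :=
    (QuotientGroup.mk' _).comp (Subgroup.topEquiv.symm.toMonoidHom)
  have hs : Function.Surjective f :=
    (QuotientGroup.mk'_surjective _).comp (Subgroup.topEquiv.symm.surjective)
  have hi : Function.Injective f := by
    rw [injective_iff_map_eq_one]
    intro a ha
    have := (QuotientGroup.eq_one_iff _).1 ha
    simpa [Subgroup.mem_subgroupOf] using this
  constructor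
  · intro h
    exact Subgroup.isNilpotent_of_ker_le_center f (by rw [(MonoidHom.ker_eq_bot_iff f).2 hi]; exact bot_le)
  · intro h
    exact Group.nilpotent_of_surjective f hs

theorem spnt_iff {p : ℕ} {X : Type u} [Group X] : SpNt p 1 X ↔ FF p X := by
  constructor
  · rintro ⟨N, hN, hp, H, hn, h0, h1, -, h3⟩
    exact ⟨N, hN, hp, (nilp_factor _ _ (hn _) h0 h1).1 (h3 0)⟩
  · rintro ⟨N, hN, hp, h⟩
    refine ⟨N, hN, hp, fun i => if i = 0 then ⊥ else ⊤, ?_, by simp, by simp, ?_, ?_⟩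
    · intro i
      dsimp only
      split_ifs <;> infer_instance
    · intro i
      simp
    · intro i
      rw [nilp_factor]
      · exact h
      · have : i = 0 := Subsingleton.elim _ _
        simp [this]
      · simp

theorem FF.of_injective {p : ℕ} {X : Type u} [Group X] {Y : Type u} [Group Y] (f : X →* Y)
    (hf : Function.Injective f) (h : FF p Y) : FF p X := by
  obtain ⟨N, hN, hp, hn⟩ := h
  refine ⟨N.comap f, inferInstance, hp.comap_of_injective f hf, ?_⟩
  let g : X ⧸ N.comap f →* Y ⧸ N := QuotientGroup.map _ _ f le_rfl
  have hg : Function.Injective g := by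
    rw [injective_iff_map_eq_one]
    intro a
    induction a using QuotientGroup.induction_on with
    | H a =>
      intro h
      exact (QuotientGroup.eq_one_iff a).2 ((QuotientGroup.eq_one_iff (f a)).1 h)
  exact Subgroup.isNilpotent_of_ker_le_center g (by rw [(MonoidHom.ker_eq_bot_iff g).2 hg]; exact bot_le)

theorem FF.of_surjective {p : ℕ} {X : Type u} [Group X] {Y : Type u} [Group Y] (f : X →* Y)
    (hf : Function.Surjective f) (h : FF p X) : FF p Y := by
  obtain ⟨N, hN, hp, hn⟩ := h
  have hM : (N.map f).Normal := hN.map f hf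
  refine ⟨N.map f, hM, hp.map f, ?_⟩
  let g : X ⧸ N →* Y ⧸ N.map f := QuotientGroup.map _ _ f (Subgroup.le_comap_map f N)
  have hg : Function.Surjective g := by
    intro y
    induction y using QuotientGroup.induction_on with
    | H y =>
      obtain ⟨x, rfl⟩ := hf y
      exact ⟨x, rfl⟩
  exact Group.nilpotent_of_surjective g hg

theorem FF.mono {p : ℕ} {X : Type u} [Group X] {H K : Subgroup X} (h : FF p K) (hle : H ≤ K) : FF p H :=
  h.of_injective (Subgroup.inclusion hle) (Subgroup.inclusion_injective hle)

/-- in finite nilpotent groups: elements of coprime prime power order commute -/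
theorem nilp_commute {X : Type u} [Group X] [Finite X] [Group.IsNilpotent X] {q r : ℕ} (hq : q.Prime)
    (hr : r.Prime) (hqr : q ≠ r) {a b : X} (ha : PEl q a) (hb : PEl r b) : Commute a b := by
  have := Fact.mk hq
  have := Fact.mk hr
  obtain ⟨Q, hQ⟩ := (ps_iff.1 ha.zpowers).exists_le_sylow
  obtain ⟨R, hR⟩ := (ps_iff.1 hb.zpowers).exists_le_sylow
  have hd : Disjoint (Q : Subgroup X) (R : Subgroup X) := IsPGroup.disjoint_of_ne q r hqr _ _ Q.2 R.2
  have hQn : (Q : Subgroup X).Normal := inferInstance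
  have hRn : (R : Subgroup X).Normal := inferInstance
  exact Subgroup.commute_of_normal_of_disjoint _ _ hQn hRn hd a b (hQ (Subgroup.mem_zpowers _)) (hR (Subgroup.mem_zpowers _))

/-- the normal subgroup of all p-elements in a finite nilpotent group -/
theorem nilp_sylow {X : Type u} [Group X] [Finite X] [Group.IsNilpotent X] {q : ℕ} (hq : q.Prime) :
    ∃ Q : Subgroup X, Q.Normal ∧ PS q Q ∧ ∀ z, PEl q z → z ∈ Q := by
  have := Fact.mk hq
  obtain ⟨Q⟩ : Nonempty (Sylow q X) := inferInstance
  have hQn : (Q : Subgroup X).Normal := inferInstance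
  refine ⟨Q, hQn, ps_iff.2 Q.2, fun z hz => ?_⟩
  have h := ps_sup hz.zpowers (ps_iff.2 Q.2) (Subgroup.le_normalizer_of_normal)
  have := Q.is_maximal' (ps_iff.1 h) le_sup_right
  change z ∈ (Q : Subgroup X)
  change _ = (Q : Subgroup X) at this
  rw [← this]
  exact Subgroup.mem_sup_left (Subgroup.mem_zpowers _)

theorem FF.struct {p : ℕ} (hp : p.Prime) {X : Type u} [Group X] [Finite X] (h : FF p X) :
    ∃ (V : Subgroup X) (_ : V.Normal), PS p V ∧ Group.IsNilpotent (X ⧸ V) ∧ (∀ z, PEl p z → z ∈ V) ∧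
      ∀ q r : ℕ, q.Prime → r.Prime → q ≠ r → ∀ a b : X, PEl q a → PEl r b → a * b * a⁻¹ * b⁻¹ ∈ V := by
  obtain ⟨N, hN, hNp, hn⟩ := h
  obtain ⟨Q, hQn, hQ, hQz⟩ := nilp_sylow (X := X ⧸ N) hp
  refine ⟨Q.comap (QuotientGroup.mk' N), inferInstance, ?_, ?_, ?_, ?_⟩
  · intro g hg
    obtain ⟨n, hn⟩ := hQ _ hg
    rw [← map_pow] at hn
    have h1 : g ^ p ^ n ∈ N := (QuotientGroup.eq_one_iff _).1 hn
    obtain ⟨m, hm⟩ := ps_iff.2 hNp _ h1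
    exact ⟨n + m, by rw [pow_add, pow_mul, hm]⟩
  · let g : X ⧸ N →* X ⧸ Q.comap (QuotientGroup.mk' N) :=
      QuotientGroup.map _ _ (MonoidHom.id X) (by
        intro n hn
        change (n : X ⧸ N) ∈ Q
        rw [(QuotientGroup.eq_one_iff n).2 hn]
        exact one_mem _)
    have hg : Function.Surjective g := by
      intro y
      induction y using QuotientGroup.induction_on with
      | H y => exact ⟨y, rfl⟩
    exact Group.nilpotent_of_surjective g hg
  · intro z hz
    exact hQz _ (hz.map _)
  · intro q r hq hr hqr a b ha hb
    have h1 := nilp_commute hq hr hqr (ha.map (QuotientGroup.mk' N)) (hb.map (QuotientGroup.mk' N))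
    change (QuotientGroup.mk' N) (a * b * a⁻¹ * b⁻¹) ∈ Q
    rw [map_mul, map_mul, map_mul, map_inv, map_inv, h1.eq]
    simp

section
variable {G : Type u} [Group G]

def Reg (p : ℕ) (x : G) : Prop := ∀ y, FF p (Subgroup.closure {x, y})

theorem Reg.map {p : ℕ} {G' : Type u} [Group G'] (f : G →* G') (hf : Function.Surjective f) {x : G}
    (h : Reg p x) : Reg p (f x) := by
  intro y
  obtain ⟨y, rfl⟩ := hf y
  have h1 : Subgroup.closure {f x, f y} = (Subgroup.closure {x, y}).map f := by
    rw [MonoidHom.map_closure, Set.image_pair]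
  rw [h1]
  exact (h y).of_surjective _ (MonoidHom.subgroupMap_surjective f _)

theorem Reg.conj {p : ℕ} {x : G} (h : Reg p x) (g : G) : Reg p (g * x * g⁻¹) := by
  have := h.map (MulAut.conj g).toMonoidHom (MulAut.conj g).surjective
  simpa using this

theorem Reg.sub {p : ℕ} {x : G} (h : Reg p x) {H : Subgroup G} (hx : x ∈ H) : Reg p (⟨x, hx⟩ : H) := by
  intro y
  have hle : Subgroup.closure {(⟨x, hx⟩ : H), y} ≤ (Subgroup.closure {x, (y : G)}).comap H.subtype := by
    rw [Subgroup.closure_le]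
    rintro s (rfl | rfl)
    · exact Subgroup.subset_closure (by simp)
    · exact Subgroup.subset_closure (by simp)
  let f : Subgroup.closure {(⟨x, hx⟩ : H), y} →* Subgroup.closure {x, (y : G)} :=
    (H.subtype.comp (Subgroup.subtype _)).codRestrict _ (fun z => hle z.2)
  refine (h y).of_injective f ?_
  intro a b hab
  have h1 := congrArg Subtype.val hab
  exact Subtype.ext (Subtype.ext h1)

theorem Reg.mem {p : ℕ} {x z : G} (h : Reg p x) (hz : z ∈ Subgroup.zpowers x) : Reg p z := by
  intro y
  refine (h y).mono ?_
  rw [Subgroup.closure_le]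
  have h1 : x ∈ Subgroup.closure {x, y} := Subgroup.subset_closure (by simp)
  rintro s (rfl | rfl)
  · exact (Subgroup.zpowers_le.2 h1) hz
  · exact Subgroup.subset_closure (by simp)

theorem FF.sub {p : ℕ} (hp : p.Prime) [Finite G] {H : Subgroup G} (h : FF p H) :
    ∃ V ≤ H, PS p V ∧ H ≤ Nm V ∧ (∀ z ∈ H, PEl p z → z ∈ V) ∧
      ∀ q r : ℕ, q.Prime → r.Prime → q ≠ r → ∀ a ∈ H, ∀ b ∈ H, PEl q a → PEl r b →
        a * b * a⁻¹ * b⁻¹ ∈ V := by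
  obtain ⟨V, hV, h1, -, h2, h3⟩ := h.struct hp
  have hpe : ∀ (q : ℕ) (z : G) (hz : z ∈ H), PEl q z → PEl q (⟨z, hz⟩ : H) := by
    rintro q z hz ⟨n, hn⟩
    exact ⟨n, by ext; simpa using hn⟩
  refine ⟨V.map H.subtype, Subgroup.map_subtype_le V, ?_, ?_, ?_, ?_⟩
  · exact ps_iff.2 ((ps_iff.1 h1).map _)
  · intro a ha
    apply nm_of
    rintro _ ⟨v, hv, rfl⟩
    exact ⟨⟨a, ha⟩ * v * ⟨a, ha⟩⁻¹, hV.conj_mem _ hv _, rfl⟩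
  · intro z hz hzp
    exact ⟨⟨z, hz⟩, h2 _ (hpe _ _ _ hzp), rfl⟩
  · intro q r hq hr hqr a ha b hb hqa hrb
    exact ⟨_, h3 q r hq hr hqr ⟨a, ha⟩ ⟨b, hb⟩ (hpe _ _ _ hqa) (hpe _ _ _ hrb), rfl⟩

/-- commutator of a regular q-element with r-element is a p-element -/
theorem Reg.comm {p q r : ℕ} (hp : p.Prime) (hq : q.Prime) (hr : r.Prime) (hqr : q ≠ r) [Finite G] {x b : G}
    (h : Reg p x) (hx : PEl q x) (hb : PEl r b) : PEl p (x * b * x⁻¹ * b⁻¹) := by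
  obtain ⟨V, -, hV, -, -, h3⟩ := (h b).sub hp
  exact hV _ (h3 q r hq hr hqr x (Subgroup.subset_closure (by simp)) b (Subgroup.subset_closure (by simp)) hx hb)

end


section
variable {G : Type u} [Group G]

def Loc (p q : ℕ) (H : Subgroup G) (x : G) : Prop :=
  ∃ N K : Subgroup G, N ≤ K ∧ K ≤ H ∧ H ≤ Nm N ∧ H ≤ Nm K ∧ PS p N ∧ x ∈ K ∧
    ∀ k ∈ K, ∃ n : ℕ, k ^ q ^ n ∈ N

theorem Loc.sub [Finite G] {p q : ℕ} {H : Subgroup G} {x : H} (h : Loc p q (⊤ : Subgroup H) x) :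
    Loc p q H (x : G) := by
  obtain ⟨N, K, h1, -, h3, h4, h5, h6, h7⟩ := h
  have hm : ∀ D : Subgroup H, ⊤ ≤ Nm D → H ≤ Nm (D.map H.subtype) := by
    intro D hD a ha
    apply nm_of
    rintro _ ⟨d, hd, rfl⟩
    exact ⟨⟨a, ha⟩ * d * ⟨a, ha⟩⁻¹, Nm.conj (hD (Subgroup.mem_top _)) hd, rfl⟩
  refine ⟨N.map H.subtype, K.map H.subtype, Subgroup.map_mono h1, Subgroup.map_subtype_le K,
    hm _ h3, hm _ h4, ps_iff.2 ((ps_iff.1 h5).map _), ⟨x, h6, rfl⟩, ?_⟩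
  rintro _ ⟨k, hk, rfl⟩
  obtain ⟨n, hn⟩ := h7 k hk
  exact ⟨n, ⟨_, hn, rfl⟩⟩

theorem Loc.quot {p q : ℕ} {N0 : Subgroup G} (hN0 : N0.Normal) (hp : PS p N0) {x : G}
    (h : Loc p q (⊤ : Subgroup (G ⧸ N0)) (QuotientGroup.mk' N0 x)) : Loc p q ⊤ x := by
  obtain ⟨N, K, h1, -, h3, h4, h5, h6, h7⟩ := h
  have hm : ∀ D : Subgroup (G ⧸ N0), ⊤ ≤ Nm D → ⊤ ≤ Nm (D.comap (QuotientGroup.mk' N0)) := by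
    intro D hD a _
    rw [mem_Nm]
    intro d
    have := mem_Nm.1 (hD (Subgroup.mem_top (QuotientGroup.mk' N0 a))) (QuotientGroup.mk' N0 d)
    rw [Subgroup.mem_comap, Subgroup.mem_comap, this, map_mul, map_mul, map_inv]
  refine ⟨N.comap (QuotientGroup.mk' N0), K.comap (QuotientGroup.mk' N0), Subgroup.comap_mono h1, le_top,
    hm _ h3, hm _ h4, ?_, h6, ?_⟩
  · intro g hg
    obtain ⟨n, hn⟩ := h5 _ hg
    rw [← map_pow] at hn
    obtain ⟨m, hm⟩ := hp _ ((QuotientGroup.eq_one_iff _).1 hn)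
    exact ⟨n + m, by rw [pow_add, pow_mul, hm]⟩
  · intro k hk
    obtain ⟨n, hn⟩ := h7 _ hk
    exact ⟨n, by rwa [Subgroup.mem_comap, map_pow]⟩

structure Ctx (p q : ℕ) (x : G) : Prop where
  hp : p.Prime
  hq : q.Prime
  hpq : p ≠ q
  hx : PEl q x
  reg : Reg p x
  nop : ∀ N : Subgroup G, N.Normal → PS p N → N = ⊥
  loc : ∀ H : Subgroup G, H ≠ ⊤ → ∀ g : G, g * x * g⁻¹ ∈ H → Loc p q H (g * x * g⁻¹)
  nl : ¬ Loc p q ⊤ x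

end

theorem main_of_ctx {p q : ℕ} (hp : p.Prime) (hq : q.Prime) (hpq : p ≠ q)
    (hctx : ∀ (G : Type u) [Group G] [Finite G] (x : G), Ctx p q x → False) :
    ∀ (n : ℕ) (G : Type u) [Group G] [Finite G] (x : G), Nat.card G = n → PEl q x → Reg p x → Loc p q ⊤ x := by
  intro n
  induction n using Nat.strong_induction_on with
  | _ n ih =>
  intro G _ _ x hn hx hreg
  by_contra hnl
  refine hctx G x ⟨hp, hq, hpq, hx, hreg, ?_, ?_, hnl⟩
  · intro N hN hNp
    by_contra hne
    apply hnl
    apply Loc.quot hN hNp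
    refine ih (Nat.card (G ⧸ N)) ?_ (G ⧸ N) _ rfl (hx.map _) (hreg.map _ (QuotientGroup.mk'_surjective N))
    rw [← hn, Subgroup.card_eq_card_quotient_mul_card_subgroup N]
    have h1 : 1 < Nat.card N := by
      rw [Subgroup.one_lt_card_iff_ne_bot]; exact hne
    have h2 : 0 < Nat.card (G ⧸ N) := Nat.card_pos
    nlinarith
  · intro H hH g hg
    have h1 : Nat.card H < Nat.card G := by
      refine lt_of_le_of_ne (Subgroup.card_le_card_group H) (fun h => hH (Subgroup.card_eq_iff_eq_top H |>.1 h))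
    refine Loc.sub (x := ⟨g * x * g⁻¹, hg⟩) (ih (Nat.card H) (hn ▸ h1) H _ rfl ?_ ((hreg.conj g).sub hg))
    obtain ⟨m, hm⟩ := hx.conj g
    exact ⟨m, by ext; simpa using hm⟩

section
variable {G : Type u} [Group G] [Finite G]

theorem pel_mem_of_pow {p q : ℕ} (hp : p.Prime) (hq : q.Prime) (hpq : p ≠ q) {N : Subgroup G} {w : G}
    (hw : PEl p w) {n : ℕ} (h : w ^ q ^ n ∈ N) : w ∈ N := by
  obtain ⟨m, hm⟩ := hw
  have hc : Nat.Coprime (q ^ n) (orderOf w) :=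
    Nat.Coprime.coprime_dvd_right (orderOf_dvd_of_pow_eq_one hm)
      (Nat.Coprime.pow _ _ ((Nat.coprime_primes hq hp).2 hpq.symm))
  obtain ⟨k, hk⟩ := exists_pow_eq_self_of_coprime hc
  rw [← hk]
  exact pow_mem h k

theorem locComm {p q r : ℕ} (hp : p.Prime) (hq : q.Prime) (hpq : p ≠ q) (hr : r.Prime) (hqr : q ≠ r)
    {x : G} (hreg : Reg p x) (hx : PEl q x) {N K : Subgroup G} (hxK : x ∈ K)
    (hKN : ∀ k ∈ K, ∃ n : ℕ, k ^ q ^ n ∈ N) {b : G} (hb : b ∈ Nm K) (hrb : PEl r b) :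
    x * b * x⁻¹ * b⁻¹ ∈ N := by
  have h1 := hreg.comm hp hq hr hqr hx hrb
  have h2 : x * b * x⁻¹ * b⁻¹ ∈ K := by
    have := mul_mem hxK (Nm.conj hb (inv_mem hxK))
    simpa [mul_assoc] using this
  obtain ⟨n, hn⟩ := hKN _ h2
  exact pel_mem_of_pow hp hq hpq h1 hn

variable {p q : ℕ} {x : G}

theorem Ctx.locz (c : Ctx p q x) {H : Subgroup G} (hH : H ≠ ⊤) (hx : x ∈ H) :
    ∃ N K : Subgroup G, N ≤ K ∧ K ≤ H ∧ H ≤ Nm N ∧ H ≤ Nm K ∧ PS p N ∧ x ∈ K ∧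
    (∀ k ∈ K, ∃ n : ℕ, k ^ q ^ n ∈ N) ∧
    ∀ r : ℕ, r.Prime → q ≠ r → ∀ b ∈ H, PEl r b → x * b * x⁻¹ * b⁻¹ ∈ N := by
  have h := c.loc H hH 1 (by simpa using hx)
  rw [one_mul, inv_one, mul_one] at h
  obtain ⟨N, K, h1, h2, h3, h4, h5, h6, h7⟩ := h
  exact ⟨N, K, h1, h2, h3, h4, h5, h6, h7, fun r hr hqr b hb hrb =>
    locComm c.hp c.hq c.hpq hr hqr c.reg c.hx h6 h7 (h4 hb) hrb⟩

theorem loc_of_normal_q {N : Subgroup G} (hN : N.Normal) (hq : PS q N) (hx : x ∈ N) : Loc p q ⊤ x := by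
  refine ⟨⊥, N, bot_le, le_top, ?_, ?_, ps_bot, hx, ?_⟩
  · exact Subgroup.le_normalizer_of_normal
  · exact Subgroup.le_normalizer_of_normal
  · intro k hk
    obtain ⟨n, hn⟩ := hq k hk
    exact ⟨n, by rw [hn]; exact one_mem _⟩

theorem Ctx.endgame (c : Ctx p q x) (h : ∀ z, PEl p z → Commute x z) : False := by
  apply c.nl
  have key : ∀ g, PS q (Subgroup.closure {x, g * x * g⁻¹}) := by
    intro g
    have hFF := c.reg (g * x * g⁻¹)
    generalize hH : Subgroup.closure {x, g * x * g⁻¹} = H at hFF ⊢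
    obtain ⟨V, hV, hVp, hnil, -, -⟩ := hFF.struct c.hp
    have hc : V ≤ Subgroup.center H := by
      intro v hv
      obtain ⟨n, hn⟩ := hVp v hv
      have hvp : PEl p (v : G) := ⟨n, by simpa using congrArg Subtype.val hn⟩
      have hle : H ≤ Subgroup.centralizer {(v : G)} := by
        refine hH.symm.le.trans ?_
        rw [Subgroup.closure_le]
        rintro s (rfl | rfl)
        · rw [SetLike.mem_coe, Subgroup.mem_centralizer_singleton_iff]
          exact (h _ hvp).eq
        · rw [SetLike.mem_coe, Subgroup.mem_centralizer_singleton_iff]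
          have h1 := (h _ (hvp.conj' g)).eq
          calc g * x * g⁻¹ * v = g * (x * (g⁻¹ * v * g)) * g⁻¹ := by group
            _ = v * (g * x * g⁻¹) := by rw [h1]; group
      rw [Subgroup.mem_center_iff]
      intro a
      ext
      exact (Subgroup.mem_centralizer_singleton_iff.1 (hle a.2))
    have hnilH : Group.IsNilpotent H :=
      Subgroup.isNilpotent_of_ker_le_center (QuotientGroup.mk' V) (by rwa [QuotientGroup.ker_mk'])
    obtain ⟨Q, -, hQ, hQz⟩ := nilp_sylow (X := H) c.hq
    have hpe : ∀ (z : G) (hz : z ∈ H), PEl q z → PEl q (⟨z, hz⟩ : H) := by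
      rintro z hz ⟨n, hn⟩
      exact ⟨n, by ext; simpa using hn⟩
    have hle : H ≤ Q.map H.subtype := by
      have hx1 : x ∈ H := hH ▸ Subgroup.subset_closure (by simp)
      have hx2 : g * x * g⁻¹ ∈ H := hH ▸ Subgroup.subset_closure (by simp)
      have : Subgroup.closure {x, g * x * g⁻¹} ≤ Q.map H.subtype := by
        rw [Subgroup.closure_le]
        rintro s (rfl | rfl)
        · exact ⟨⟨_, hx1⟩, hQz _ (hpe _ hx1 c.hx), rfl⟩
        · exact ⟨⟨_, hx2⟩, hQz _ (hpe _ hx2 (c.hx.conj g)), rfl⟩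
      exact hH.symm.le.trans this
    exact (ps_iff.2 ((ps_iff.1 hQ).map H.subtype)).mono hle
  obtain ⟨N, h1, h2, h3⟩ := bsN c.hq x key
  exact loc_of_normal_q h1 h2 h3

theorem Ctx.lemN (c : Ctx p q x) {N0 : Subgroup G} (hN : N0.Normal) (hx : x ∈ N0) : N0 = ⊤ := by
  by_contra hne
  obtain ⟨N, K, h1, h2, h3, h4, h5, h6, h7, -⟩ := c.locz hne hx
  have hbot : N = ⊥ := by
    rw [eq_bot_iff]
    intro a ha
    obtain ⟨M, hM1, hM2, hM3⟩ := subnorm c.hp hN (h1.trans h2) h5 h3 ha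
    rwa [c.nop M hM1 hM2] at hM3
  have hKq : PS q K := by
    intro k hk
    obtain ⟨n, hn⟩ := h7 k hk
    rw [hbot, Subgroup.mem_bot] at hn
    exact ⟨n, hn⟩
  obtain ⟨M, hM1, hM2, hM3⟩ := subnorm c.hq hN h2 hKq h4 h6
  exact c.nl (loc_of_normal_q hM1 hM2 hM3)

theorem Ctx.sylX (c : Ctx p q x) {D : Subgroup G} (hD : PS p D) (hx : x ∈ Nm D) :
    ∃ R, MaxP p ⊤ R ∧ D ≤ R ∧ x ∈ Nm R := by
  obtain ⟨R, hDR, ⟨hR, hxR⟩, hmax⟩ := exMax (fun R => PS p R ∧ x ∈ Nm R) ⟨hD, hx⟩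
  obtain ⟨P, hP, hRP⟩ := exMaxP (K := ⊤) le_top hR
  by_cases hPR : P ≤ R
  · have : P = R := le_antisymm hPR hRP
    subst this
    exact ⟨P, hP, hDR, hxR⟩
  · exfalso
    obtain ⟨y, hyP, hyR, hyN⟩ := grow c.hp hP.2.1 hRP hPR
    obtain ⟨V, hV1, hV2, hV3, hV4, -⟩ := (c.reg y).sub c.hp
    have hcl : Subgroup.closure {x, y} ≤ Nm R := by
      rw [Subgroup.closure_le]
      rintro s (rfl | rfl)
      · exact hxR
      · exact hyN
    have hxc : x ∈ Subgroup.closure {x, y} := Subgroup.subset_closure (by simp)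
    have h1 := hmax (V ⊔ R) ⟨ps_sup hV2 hR (hV1.trans hcl), nm_sup (hV3 hxc) hxR⟩ le_sup_right
    exact hyR (h1 (Subgroup.mem_sup_left (hV4 y (Subgroup.subset_closure (by simp)) (hP.2.1 y hyP))))

theorem Ctx.sylEl (c : Ctx p q x) {z : G} (hz : PEl p z) : ∃ R, MaxP p ⊤ R ∧ z ∈ R ∧ x ∈ Nm R := by
  obtain ⟨V, hV1, hV2, hV3, hV4, -⟩ := (c.reg z).sub c.hp
  obtain ⟨R, h1, h2, h3⟩ := c.sylX hV2 (hV3 (Subgroup.subset_closure (by simp)))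
  exact ⟨R, h1, h2 (hV4 z (Subgroup.subset_closure (by simp)) hz), h3⟩

theorem Ctx.atom (c : Ctx p q x) {R : Subgroup G} (hR : PS p R) (hxR : x ∈ Nm R) {n : G} (hn : n ∈ R) :
    ∃ u ∈ R, u ∈ Subgroup.closure {x, u * x * u⁻¹} ∧ Commute x (u⁻¹ * n) := by
  set W := Subgroup.closure {x, n * x * n⁻¹} with hW
  have hx1 : x ∈ W := Subgroup.subset_closure (by simp)
  have hx2 : n * x * n⁻¹ ∈ W := Subgroup.subset_closure (by simp)
  have hv : (n⁻¹)⁻¹ * (x * n⁻¹ * x⁻¹) ∈ R ⊓ W := by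
    rw [Subgroup.mem_inf, inv_inv]
    refine ⟨mul_mem hn (Nm.conj hxR (inv_mem hn)), ?_⟩
    have := mul_mem hx2 (inv_mem hx1)
    simpa [mul_assoc] using this
  obtain ⟨d, hd, j, hj, hdj⟩ := cop c.hp c.hq c.hpq c.hx (hR.mono inf_le_left)
    (nm_inf hxR (le_Nm hx1)) hv
  have hn' : n = j⁻¹ * d⁻¹ := by rw [← inv_inv n, hdj]; group
  have hconj : j⁻¹ * x * j⁻¹⁻¹ = n * x * n⁻¹ := by
    have h1 : d⁻¹ * x * d = x := by rw [mul_assoc, hd.eq]; group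
    rw [hn']
    calc j⁻¹ * x * j⁻¹⁻¹ = j⁻¹ * (d⁻¹ * x * d) * j⁻¹⁻¹ := by rw [h1]
      _ = _ := by group
  refine ⟨j⁻¹, inv_mem hj.1, ?_, ?_⟩
  · rw [hconj]; exact inv_mem hj.2
  · have : (j⁻¹)⁻¹ * n = d⁻¹ := by rw [hn']; group
    rw [this]
    exact hd.inv_right

theorem Ctx.atomC (c : Ctx p q x) {u d : G} (hup : PEl p u) (hu : u ∈ Subgroup.closure {x, u * x * u⁻¹})
    (hd : PEl p d) (hdx : Commute x d) : ∃ R, MaxP p ⊤ R ∧ x ∈ Nm R ∧ u ∈ R ∧ d ∈ R := by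
  obtain ⟨V, hV1, hV2, hV3, hV4, -⟩ := (c.reg (u * d)).sub c.hp
  have hx1 : x ∈ Subgroup.closure {x, u * d} := Subgroup.subset_closure (by simp)
  have hx2 : u * d ∈ Subgroup.closure {x, u * d} := Subgroup.subset_closure (by simp)
  have hu1 : u ∈ Subgroup.closure {x, u * d} := by
    have : Subgroup.closure {x, u * x * u⁻¹} ≤ Subgroup.closure {x, u * d} := by
      rw [Subgroup.closure_le]
      rintro s (rfl | rfl)
      · exact hx1
      · have h1 := mul_mem (mul_mem hx2 hx1) (inv_mem hx2)
        have h2 : u * d * x * (u * d)⁻¹ = u * x * u⁻¹ := by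
          calc u * d * x * (u * d)⁻¹ = u * (d * x) * d⁻¹ * u⁻¹ := by group
            _ = _ := by rw [← hdx.eq]; group
        rw [h2] at h1
        exact h1
    exact this hu
  have hd1 : d ∈ Subgroup.closure {x, u * d} := by simpa using mul_mem (inv_mem hu1) hx2
  obtain ⟨R, h1, h2, h3⟩ := c.sylX hV2 (hV3 hx1)
  exact ⟨R, h1, h3, h2 (hV4 u hu1 hup), h2 (hV4 d hd1 hd)⟩

end


section
variable {G : Type u} [Group G] [Finite G]
variable {p q : ℕ} {x : G}

theorem nm_normal {N : Subgroup G} (h : N.Normal) (g : G) : g ∈ Nm N :=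
  (Subgroup.le_normalizer_of_normal (K := ⊤)) (Subgroup.mem_top g)

theorem Ctx.nfpf (c : Ctx p q x) (h : ∀ d, PEl p d → Commute x d → d = 1) : False := by
  set L := Subgroup.closure {z : G | PEl p z} with hL
  have hLn : ∀ g, g ∈ Nm L := fun g => nm_closure fun a (ha : PEl p a) => PEl.conj ha g
  have hLp : ∀ z, PEl p z → z ∈ L := fun z hz => Subgroup.subset_closure hz
  have claim1 : ∀ z, PEl p z → ∃ r ∈ L, x * z = r * x * r⁻¹ := by
    intro z hz
    obtain ⟨R, hR, hzR, hxR⟩ := c.sylEl hz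
    obtain ⟨n, hn, e⟩ := surj hxR (fun d hd hc => h d (hR.2.1 d hd) hc) z hzR
    exact ⟨n, hLp n (hR.2.1 n hn), e⟩
  have step : ∀ l z, PEl p z → (∃ k ∈ L, x * l = k * x * k⁻¹) → ∃ k ∈ L, x * (l * z) = k * x * k⁻¹ := by
    rintro l z hz ⟨k, hk, e⟩
    obtain ⟨r, hr, e2⟩ := claim1 _ (hz.conj' k)
    refine ⟨k * r, mul_mem hk hr, ?_⟩
    calc x * (l * z) = k * (x * (k⁻¹ * z * k)) * k⁻¹ := by rw [← mul_assoc, e]; group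
      _ = _ := by rw [e2]; group
  have claim2 : ∀ l ∈ L, ∃ k ∈ L, x * l = k * x * k⁻¹ := by
    intro l hl
    induction hl using Subgroup.closure_induction_right with
    | one => exact ⟨1, one_mem _, by simp⟩
    | mul_right a _ z hz ih => exact step a z hz ih
    | mul_inv_cancel a _ z hz ih => exact step a z⁻¹ (PEl.inv hz) ih
  have claim3 : ∀ d ∈ L, Commute x d → d = 1 := by
    let f : L → L := fun n => ⟨x⁻¹ * n * x * (n : G)⁻¹, mul_mem (Nm.conj' (hLn x) n.2) (inv_mem n.2)⟩
    have hf : Function.Surjective f := by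
      rintro ⟨m, hm⟩
      obtain ⟨k, hk, e⟩ := claim2 m hm
      refine ⟨⟨k, hk⟩, ?_⟩
      ext
      change x⁻¹ * k * x * k⁻¹ = m
      calc x⁻¹ * k * x * k⁻¹ = x⁻¹ * (k * x * k⁻¹) := by group
        _ = m := by rw [← e]; group
    have hi := Finite.injective_iff_surjective.2 hf
    intro d hd hc
    have : (⟨d, hd⟩ : L) = 1 := by
      apply hi
      ext
      change x⁻¹ * d * x * d⁻¹ = x⁻¹ * 1 * x * (1 : G)⁻¹
      rw [mul_assoc x⁻¹ d x, ← hc.eq]; group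
    exact congrArg Subtype.val this
  have claim4 : ∀ R R', MaxP p ⊤ R → MaxP p ⊤ R' → x ∈ Nm R → x ∈ Nm R' → R' ≤ R := by
    intro R R' hR hR' hxR hxR'
    have hm : ∀ R, MaxP p ⊤ R → MaxP p L R := fun R hR =>
      ⟨fun r hr => hLp r (hR.2.1 r hr), hR.2.1, fun Q _ hQ hle => hR.2.2 Q le_top hQ hle⟩
    obtain ⟨l, hl, hlr⟩ := (hm R hR).conj c.hp (hm R' hR')
    have h1 : l⁻¹ * x * l ∈ Nm R := by
      apply nm_of
      intro d hd
      have h2 : l * d * l⁻¹ ∈ R' := by rw [hlr]; simpa [mul_assoc] using hd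
      have h3 := (hlr _).1 (Nm.conj hxR' h2)
      simpa [mul_assoc] using h3
    have h2 : x⁻¹ * (l⁻¹ * x * l) ∈ Nm R ⊓ L := by
      refine ⟨(Nm R).mul_mem ((Nm R).inv_mem hxR) h1, ?_⟩
      have := mul_mem (Nm.conj' (hLn x) (inv_mem hl)) hl
      simpa [mul_assoc] using this
    obtain ⟨n, hn, e⟩ := surj (nm_inf (le_Nm hxR) (hLn x)) (fun d hd => claim3 d hd.2) _ h2
    have h3 : l * n = 1 := by
      apply claim3 _ (mul_mem hl hn.2)
      have e' : l⁻¹ * x * l = n * x * n⁻¹ := by rw [← e]; group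
      change x * (l * n) = l * n * x
      calc x * (l * n) = l * (l⁻¹ * x * l) * n := by group
        _ = _ := by rw [e']; group
    have h4 : l ∈ Nm R := by rw [mul_eq_one_iff_eq_inv.1 h3]; exact inv_mem hn.1
    intro g hg
    have h5 := Nm.conj h4 ((hlr g).1 hg)
    simpa [mul_assoc] using h5
  obtain ⟨R, hR, -, hxR⟩ := c.sylX (D := ⊥) ps_bot (nm_normal inferInstance x)
  have hall : ∀ z, PEl p z → z ∈ R := by
    intro z hz
    obtain ⟨R', hR', hzR', hxR'⟩ := c.sylEl hz
    exact claim4 R R' hR hR' hxR hxR' hzR'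
  have hb : R = ⊥ := c.nop R ⟨fun n hn g => hall _ ((hR.2.1 n hn).conj g)⟩ hR.2.1
  apply c.endgame
  intro z hz
  have := hall z hz
  rw [hb, Subgroup.mem_bot] at this
  rw [this]
  exact Commute.one_right x

/-- conjugate under the centralizer of x -/
def CC (x : G) (R R' : Subgroup G) : Prop := ∃ k, Commute x k ∧ ∀ g, g ∈ R' ↔ k⁻¹ * g * k ∈ R

theorem CC.symm {R R' : Subgroup G} (h : CC x R R') : CC x R' R := by
  obtain ⟨k, hk, h⟩ := h
  refine ⟨k⁻¹, hk.inv_right, fun g => ?_⟩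
  rw [h]; simp [mul_assoc]

theorem CC.trans {R R' R'' : Subgroup G} (h : CC x R R') (h' : CC x R' R'') : CC x R R'' := by
  obtain ⟨k, hk, h⟩ := h
  obtain ⟨k', hk', h'⟩ := h'
  refine ⟨k' * k, hk'.mul_right hk, fun g => ?_⟩
  rw [h', h]; simp [mul_assoc]

theorem nm_ne_top (c : Ctx p q x) {D : Subgroup G} (hD : PS p D) (hne : D ≠ ⊥) : Nm D ≠ ⊤ := by
  intro h
  exact hne (c.nop D (normal_of_Nm (fun g => by rw [h]; exact Subgroup.mem_top g)) hD)

theorem copN {p q : ℕ} (hp : p.Prime) (hq : q.Prime) (hpq : p ≠ q) {x : G} (hx : PEl q x)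
    {J : Subgroup G} (hJ : PS p J) (hn : x ∈ Nm J) {s : G} (hv : x * s⁻¹ * x⁻¹ * s⁻¹⁻¹ ∈ J) :
    ∃ c, Commute x c ∧ ∃ j ∈ J, s = c * j := by
  refine cop hp hq hpq hx hJ hn (v := s) ?_
  have := inv_mem hv
  simpa [mul_assoc] using this

theorem Ctx.F3 (c : Ctx p q x) {R R' : Subgroup G} (hR : MaxP p ⊤ R) (hR' : MaxP p ⊤ R')
    (hxR : x ∈ Nm R) (hxR' : x ∈ Nm R') (hne : R ⊓ R' ≠ ⊥) : CC x R R' := by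
  by_contra hcc
  let bad : Set (Subgroup G × Subgroup G) :=
    {PQ | MaxP p ⊤ PQ.1 ∧ MaxP p ⊤ PQ.2 ∧ x ∈ Nm PQ.1 ∧ x ∈ Nm PQ.2 ∧ PQ.1 ⊓ PQ.2 ≠ ⊥ ∧ ¬ CC x PQ.1 PQ.2}
  obtain ⟨⟨P, Q⟩, ⟨hP, hQ, hxP, hxQ, hPQ, hcPQ⟩, hmax⟩ := Set.exists_max_image bad
    (fun PQ => Nat.card ↥(PQ.1 ⊓ PQ.2)) (Set.toFinite _) ⟨(R, R'), hR, hR', hxR, hxR', hne, hcc⟩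
  clear hR hR' hxR hxR' hne hcc R R'
  dsimp only at hP hQ hxP hxQ hPQ hcPQ hmax
  have hmax' : ∀ P' Q', MaxP p ⊤ P' → MaxP p ⊤ Q' → x ∈ Nm P' → x ∈ Nm Q' → P ⊓ Q < P' ⊓ Q' → CC x P' Q' := by
    intro P' Q' h1 h2 h3 h4 hlt
    by_contra h5
    have h6 := hmax (P', Q') ⟨h1, h2, h3, h4, (lt_of_le_of_lt bot_le hlt).ne', h5⟩
    refine absurd h6 (not_le.2 ?_)
    dsimp only
    refine lt_of_le_of_ne (Subgroup.card_le_of_le hlt.le) (fun h => hlt.ne ?_)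
    exact Subgroup.eq_of_le_of_card_ge hlt.le h.symm.le
  set E := P ⊓ Q with hE
  have hEp : PS p E := hP.2.1.mono inf_le_left
  have hxE : x ∈ Nm E := nm_inf hxP hxQ
  obtain ⟨N, K, hN1, hN2, hN3, -, hN5, -, -, hN8⟩ := c.locz (nm_ne_top c hEp hPQ) hxE
  have hcom : ∀ s ∈ Nm E, PEl p s → x * s * x⁻¹ * s⁻¹ ∈ N := fun s hs hsp => hN8 p c.hp c.hpq.symm s hs hsp
  have hNM : N ≤ Nm E := hN1.trans hN2
  have side : ∀ P', MaxP p ⊤ P' → x ∈ Nm P' → E ≤ P' → ¬ P' ≤ E → ∃ S T, MaxP p (Nm E) S ∧ MaxP p ⊤ T ∧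
      S ≤ T ∧ x ∈ Nm T ∧ N ≤ S ∧ E ≤ S ∧ ¬ S ≤ E ∧ CC x P' T := by
    intro P' hP' hxP' hEP' hnE
    obtain ⟨y, hyP, hyE, hyN⟩ := grow c.hp hP'.2.1 hEP' hnE
    obtain ⟨S, hS, hle⟩ := exMaxP (p := p) (K := Nm E) (D := P' ⊓ Nm E) inf_le_right (hP'.2.1.mono inf_le_left)
    have hNS : N ≤ S := hS.le' hN5 hNM (hS.1.trans hN3)
    have hES : E ≤ S := (le_inf hEP' le_Nm).trans hle
    have hxS : x ∈ Nm S := nm_of_comm fun s hs => hNS (hcom s (hS.1 hs) (hS.2.1 s hs))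
    obtain ⟨T, hT, hST, hxT⟩ := c.sylX hS.2.1 hxS
    have hyS : y ∈ S := hle ⟨hyP, hyN⟩
    refine ⟨S, T, hS, hT, hST, hxT, hNS, hES, fun h => hyE (h hyS), ?_⟩
    apply hmax' P' T hP' hT hxP' hxT
    refine lt_of_le_of_ne (le_inf hEP' (hES.trans hST)) (fun h => hyE ?_)
    rw [h]
    exact ⟨hyP, hST hyS⟩
  have hPE : ¬ P ≤ E := by
    intro h
    have h1 : Q = P := le_antisymm (hP.2.2 Q le_top hQ.2.1 (h.trans inf_le_right)) (h.trans inf_le_right)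
    exact hcPQ ⟨1, Commute.one_right x, fun g => by rw [h1]; simp⟩
  have hQE : ¬ Q ≤ E := by
    intro h
    have h1 : P = Q := le_antisymm (hQ.2.2 P le_top hP.2.1 (h.trans inf_le_left)) (h.trans inf_le_left)
    exact hcPQ ⟨1, Commute.one_right x, fun g => by rw [h1]; simp⟩
  obtain ⟨S, T, hS, hT, hST, hxT, hNS, hES, hSE, hPT⟩ := side P hP hxP inf_le_left hPE
  obtain ⟨S', T', hS', hT', hST', hxT', hNS', hES', hSE', hQT'⟩ := side Q hQ hxQ inf_le_right hQE
  have hnTT : ¬ CC x T T' := fun h => hcPQ (hPT.trans (h.trans hQT'.symm))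
  have hNE : N ≤ E := by
    by_contra hc
    apply hnTT
    apply hmax' T T' hT hT' hxT hxT'
    refine lt_of_le_of_ne (le_inf (hES.trans hST) (hES'.trans hST')) (fun h => hc ?_)
    rw [h]
    exact le_inf (hNS.trans hST) (hNS'.trans hST')
  have hdec : ∀ s ∈ Nm E, PEl p s → ∃ d, Commute x d ∧ ∃ j ∈ E, s = d * j := by
    intro s hs hsp
    obtain ⟨d, hd, j, hj, e⟩ := copN c.hp c.hq c.hpq c.hx hN5 (hN3 hxE) (hcom s⁻¹ (inv_mem hs) hsp.inv)
    exact ⟨d, hd, j, hNE hj, e⟩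
  set C := Subgroup.centralizer {x} with hC
  have memC : ∀ g, g ∈ C ↔ Commute x g := by
    intro g
    rw [hC, Subgroup.mem_centralizer_singleton_iff]
    exact ⟨fun h => h.symm, fun h => h.symm⟩
  have hmx : ∀ S, MaxP p (Nm E) S → E ≤ S → MaxP p (C ⊓ Nm E) (S ⊓ C) := by
    intro S hS hES
    refine ⟨le_inf inf_le_right (inf_le_left.trans hS.1), hS.2.1.mono inf_le_left, ?_⟩
    intro Q hQ hQp hle
    have h1 : S ≤ Q ⊔ E := by
      intro s hs
      obtain ⟨d, hd, j, hj, e⟩ := hdec s (hS.1 hs) (hS.2.1 s hs)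
      have hdS : d ∈ S := by
        have : d = s * j⁻¹ := by rw [e]; group
        rw [this]
        exact mul_mem hs (inv_mem (hES hj))
      rw [e]
      exact mul_mem (Subgroup.mem_sup_left (hle ⟨hdS, (memC d).2 hd⟩)) (Subgroup.mem_sup_right hj)
    have h2 := hS.2.2 (Q ⊔ E) (sup_le (hQ.trans inf_le_right) le_Nm)
      (ps_sup hQp hEp (hQ.trans inf_le_right)) h1
    exact le_inf (le_sup_left.trans h2) (hQ.trans inf_le_left)
  obtain ⟨k, hk, hkS⟩ := (hmx S hS hES).conj c.hp (hmx S' hS' hES')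
  have hkx : Commute x k := (memC k).1 hk.1
  have hkE : k ∈ Nm E := hk.2
  have hsub : S' ≤ cj k T := by
    intro s hs
    obtain ⟨d, hd, j, hj, e⟩ := hdec s (hS'.1 hs) (hS'.2.1 s hs)
    have hdS : d ∈ S' := by
      have : d = s * j⁻¹ := by rw [e]; group
      rw [this]
      exact mul_mem hs (inv_mem (hES' hj))
    have h1 := (hkS d).1 ⟨hdS, (memC d).2 hd⟩
    have h2 := mul_mem h1.1 (hES (Nm.conj' hkE hj))
    rw [mem_cj]
    apply hST
    rw [e]
    simpa [mul_assoc] using h2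
  have hxT2 : x ∈ Nm (cj k T) := by
    apply nm_of
    intro d hd
    rw [mem_cj] at hd ⊢
    have h1 := Nm.conj hxT hd
    have e1 : k⁻¹ * (x * d * x⁻¹) * k = x * (k⁻¹ * d * k) * x⁻¹ := by
      calc k⁻¹ * (x * d * x⁻¹) * k = (k⁻¹ * x) * d * (x⁻¹ * k) := by group
        _ = _ := by rw [← hkx.inv_right.eq, hkx.inv_left.eq]; group
    rwa [e1]
  apply hnTT
  have h1 : CC x (cj k T) T' := by
    apply hmax' _ _ (hT.cjTop k) hT' hxT2 hxT'
    refine lt_of_le_of_ne (le_inf (hES'.trans hsub) (hES'.trans hST')) (fun h => hSE' ?_)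
    rw [h]
    exact le_inf hsub hST'
  exact CC.trans ⟨k, hkx, fun g => mem_cj⟩ h1

end


section
variable {G : Type u} [Group G] [Finite G]
variable {p q : ℕ} {x : G}

abbrev CX (x : G) : Subgroup G := Subgroup.centralizer {x}

theorem mem_CX {x g : G} : g ∈ CX x ↔ Commute x g := by
  rw [Subgroup.mem_centralizer_singleton_iff]
  exact ⟨fun h => h.symm, fun h => h.symm⟩

theorem bsNrel (hp : p.Prime) {C : Subgroup G} {c : G} (hc : c ∈ C)
    (h : ∀ g ∈ C, PS p (Subgroup.closure {c, g * c * g⁻¹})) :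
    ∃ O : Subgroup G, O ≤ C ∧ C ≤ Nm O ∧ PS p O ∧ c ∈ O := by
  have key : ∀ g : C, PS p (Subgroup.closure {(⟨c, hc⟩ : C), g * ⟨c, hc⟩ * g⁻¹}) := by
    intro g z hz
    have hle : Subgroup.closure {(⟨c, hc⟩ : C), g * ⟨c, hc⟩ * g⁻¹} ≤
        (Subgroup.closure {c, (g : G) * c * (g : G)⁻¹}).comap C.subtype := by
      rw [Subgroup.closure_le]
      rintro s (rfl | rfl)
      · exact Subgroup.subset_closure (by simp)
      · exact Subgroup.subset_closure (by simp)
    obtain ⟨n, hn⟩ := h g g.2 z (hle hz)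
    exact ⟨n, by ext; simpa using hn⟩
  obtain ⟨O, h1, h2, h3⟩ := bsN hp _ key
  refine ⟨O.map C.subtype, Subgroup.map_subtype_le O, ?_, ps_iff.2 ((ps_iff.1 h2).map _), ⟨_, h3, rfl⟩⟩
  intro a ha
  apply nm_of
  rintro _ ⟨d, hd, rfl⟩
  exact ⟨⟨a, ha⟩ * d * ⟨a, ha⟩⁻¹, h1.conj_mem _ hd _, rfl⟩

theorem Ctx.exA (c : Ctx p q x) : ∃ A, MaxP p (CX x) A ∧ ∃ a ∈ A, a ≠ 1 := by
  by_contra hcon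
  push Not at hcon
  apply c.nfpf
  intro d hd hdx
  obtain ⟨A, hA, hle⟩ := exMaxP (K := CX x) (D := Subgroup.zpowers d) (by simpa using mem_CX.2 hdx) hd.zpowers
  exact hcon A hA d (hle (Subgroup.mem_zpowers d))

theorem MaxP.inter {A : Subgroup G} (hA : MaxP p (CX x) A) {R : Subgroup G} (hR : PS p R) (hAR : A ≤ R) {g : G}
    (hg : g ∈ R) (hgx : Commute x g) : g ∈ A :=
  hA.2.2 (R ⊓ CX x) inf_le_right (hR.mono inf_le_left) (le_inf hAR hA.1) ⟨hg, mem_CX.2 hgx⟩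

theorem self_CX : x ∈ CX x := mem_CX.2 (Commute.refl x)

theorem nm_of_le_CX {A : Subgroup G} (hA : A ≤ CX x) : x ∈ Nm A := by
  apply nm_of
  intro d hd
  rw [(mem_CX.1 (hA hd)).eq]
  simpa using hd

theorem inf_ne_bot {A B : Subgroup G} {u : G} (h1 : u ∈ A) (h2 : u ∈ B) (hu : u ≠ 1) : A ⊓ B ≠ ⊥ := by
  intro h
  have : u ∈ A ⊓ B := ⟨h1, h2⟩
  rw [h, Subgroup.mem_bot] at this
  exact hu this

theorem Ctx.typeP (c : Ctx p q x) {D0 : Subgroup G} (hD0 : PS p D0) (hCD0 : CX x ≤ Nm D0) : D0 = ⊥ := by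
  by_contra hne0
  obtain ⟨D, hD0D, ⟨hD, hCD⟩, hmax⟩ := exMax (fun D => PS p D ∧ CX x ≤ Nm D) ⟨hD0, hCD0⟩
  have hne : D ≠ ⊥ := fun h => hne0 (eq_bot_iff.2 (h ▸ hD0D))
  obtain ⟨A, hA, a, haA, ha1⟩ := c.exA
  have hxD : x ∈ Nm D := hCD self_CX
  obtain ⟨N, K, hN1, hN2, hN3, -, hN5, -, -, hN8⟩ := c.locz (nm_ne_top c hD hne) hxD
  have hmaxle : ∀ O, PS p O → O ≤ Nm D → CX x ≤ Nm O → O ≤ D := fun O h1 h2 h3 =>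
    le_sup_left.trans (hmax (O ⊔ D) ⟨ps_sup h1 hD h2, fun g hg => nm_sup (h3 hg) (hCD hg)⟩ le_sup_right)
  have hND : N ≤ D := hmaxle N hN5 (hN1.trans hN2) (hCD.trans hN3)
  obtain ⟨R, hR, hle, hxR⟩ := c.sylX (ps_sup hA.2.1 hD (hA.1.trans hCD)) (nm_sup (nm_of_le_CX hA.1) hxD)
  have hAR : A ≤ R := le_sup_left.trans hle
  have hDR : D ≤ R := le_sup_right.trans hle
  have dec : ∀ s ∈ R, s ∈ Nm D → ∃ d ∈ A, ∃ j ∈ D, s = d * j := by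
    intro s hs hsD
    obtain ⟨d, hd, j, hj, e⟩ := copN c.hp c.hq c.hpq c.hx hN5 (hN3 hxD)
      (hN8 p c.hp c.hpq.symm s⁻¹ (inv_mem hsD) (hR.2.1 s hs).inv)
    refine ⟨d, hA.inter hR.2.1 hAR ?_ hd, j, hND hj, e⟩
    have : d = s * j⁻¹ := by rw [e]; group
    rw [this]
    exact mul_mem hs (inv_mem (hDR (hND hj)))
  have hRM : R ≤ Nm D := by
    by_contra hRM
    obtain ⟨n, hnR, hnS, hnN⟩ := grow c.hp hR.2.1 (E := R ⊓ Nm D) inf_le_left (fun h => hRM (h.trans inf_le_right))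
    obtain ⟨u, huR, hucl, hun⟩ := c.atom hR.2.1 hxR hnR
    have hc' : u⁻¹ * n ∈ R ⊓ Nm D := by
      have : u⁻¹ * n ∈ A := hA.inter hR.2.1 hAR (mul_mem (inv_mem huR) hnR) hun
      exact ⟨hAR this, hCD (hA.1 this)⟩
    have hu : u = n * (u⁻¹ * n)⁻¹ := by group
    have huS : u ∉ R ⊓ Nm D := by
      intro h
      apply hnS
      have := mul_mem h hc'
      simpa using this
    have huN : u ∈ Nm (R ⊓ Nm D) := by
      rw [hu]
      exact mul_mem hnN (inv_mem (le_Nm hc'))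
    have hu1 : u ≠ 1 := fun h => huS (h ▸ one_mem _)
    apply huS
    refine ⟨huR, ?_⟩
    apply nm_of
    intro d hd
    have h1 := Nm.conj huN (show d ∈ R ⊓ Nm D from ⟨hDR hd, le_Nm hd⟩)
    obtain ⟨s, hsA, j, hj, e⟩ := dec _ h1.1 h1.2
    suffices hsD : s ∈ D by
      rw [e]
      exact mul_mem hsD hj
    have hsb : ∀ b, PEl p b → Commute x b → PS p (Subgroup.closure {s, b}) := by
      intro b hb hbx
      obtain ⟨R2, hR2, hxR2, huR2, hbR2⟩ := c.atomC (hR.2.1 u huR) hucl hb hbx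
      obtain ⟨k, hk, hkR⟩ := c.F3 hR hR2 hxR hxR2 (inf_ne_bot huR huR2 hu1)
      have hkD : k ∈ Nm D := hCD (mem_CX.2 hk)
      have hDR2 : ∀ d ∈ D, d ∈ R2 := fun d hd => (hkR d).2 (hDR (Nm.conj' hkD hd))
      have hs : s = (u * d * u⁻¹) * j⁻¹ := by rw [e]; group
      have hsR2 : s ∈ R2 := by
        rw [hs]
        exact mul_mem (mul_mem (mul_mem huR2 (hDR2 d hd)) (inv_mem huR2)) (inv_mem (hDR2 j hj))
      refine hR2.2.1.mono ?_
      rw [Subgroup.closure_le]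
      rintro t (rfl | rfl)
      · exact hsR2
      · exact hbR2
    have hsp : PEl p s := hA.2.1 s hsA
    obtain ⟨O, hO1, hO2, hO3, hO4⟩ := bsNrel c.hp (hA.1 hsA) (fun g hg => hsb _ (hsp.conj g)
      (mem_CX.1 (mul_mem (mul_mem hg (hA.1 hsA)) (inv_mem hg))))
    exact hmaxle O hO3 (hO1.trans hCD) hO2 hO4
  have hall : ∀ z, PEl p z → z ∈ Nm D := by
    intro z hz
    obtain ⟨R1, hR1, hzR1, hxR1⟩ := c.sylEl hz
    by_cases hcom : ∀ n ∈ R1, Commute x n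
    · exact hCD (mem_CX.2 (hcom z hzR1))
    push Not at hcom
    obtain ⟨n, hn, hnx⟩ := hcom
    obtain ⟨u, huR, hucl, hun⟩ := c.atom hR1.2.1 hxR1 hn
    have hu1 : u ≠ 1 := by
      rintro rfl
      apply hnx
      simpa using hun
    obtain ⟨R2, hR2, hxR2, huR2, haR2⟩ := c.atomC (hR1.2.1 u huR) hucl (hA.2.1 a haA) (mem_CX.1 (hA.1 haA))
    have h1 := c.F3 hR1 hR2 hxR1 hxR2 (inf_ne_bot huR huR2 hu1)
    have h2 := c.F3 hR hR2 hxR hxR2 (inf_ne_bot (hAR haA) haR2 ha1)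
    obtain ⟨k, hk, hkR⟩ := h2.trans h1.symm
    have hkM : k ∈ Nm D := hCD (mem_CX.2 hk)
    have h3 := mul_mem (mul_mem hkM (hRM ((hkR z).1 hzR1))) (inv_mem hkM)
    simpa [mul_assoc] using h3
  apply hne
  rw [eq_bot_iff]
  intro d hd
  obtain ⟨N, h1, h2, h3⟩ := core (p := p) d (fun P hP => hP.le' hD le_top (fun z hz => hall z (hP.2.1 z hz)) hd)
  rwa [c.nop N h1 h2] at h3

end


section
variable {G : Type u} [Group G] [Finite G]
variable {p q : ℕ} {x : G}

def UU (p : ℕ) (x : G) : Subgroup G := Subgroup.closure {z | PEl p z ∧ Commute x z}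
def MM (p : ℕ) (x : G) : Subgroup G := Nm (UU p x)

theorem commute_of_comm {a b : G} (h : a * b * a⁻¹ * b⁻¹ = 1) : Commute a b := by
  have h1 : a * b * a⁻¹ = b := mul_inv_eq_one.1 h
  exact mul_inv_eq_iff_eq_mul.1 h1

theorem CX_le_MM : CX x ≤ MM p x := by
  intro g hg
  refine nm_closure ?_
  rintro z ⟨hz, hzx⟩
  refine ⟨hz.conj g, ?_⟩
  have hg' := mem_CX.1 hg
  exact (hg'.mul_right hzx).mul_right hg'.inv_right

theorem UU_le_MM : UU p x ≤ MM p x := le_Nm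

theorem normal_central (c : Ctx p q x) {Y : Subgroup G} (hY : Y.Normal) (hYx : Y ≤ CX x) :
    ∀ y ∈ Y, ∀ g, Commute g y := by
  have h1 : (Subgroup.centralizer (Y : Set G)).Normal := Subgroup.normal_centralizer
  have h2 : x ∈ Subgroup.centralizer (Y : Set G) := by
    rw [Subgroup.mem_centralizer_iff]
    intro h hh
    exact (mem_CX.1 (hYx hh)).symm.eq
  have h3 := c.lemN h1 h2
  intro y hy g
  have : g ∈ Subgroup.centralizer (Y : Set G) := by rw [h3]; trivial
  exact (Subgroup.mem_centralizer_iff.1 this y hy).symm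

theorem Ctx.MM_ne (c : Ctx p q x) : MM p x ≠ ⊤ := by
  intro h
  have hU : (UU p x).Normal := normal_of_Nm (fun g => by
    have : g ∈ MM p x := by rw [h]; trivial
    exact this)
  have hUx : UU p x ≤ CX x := by
    unfold UU
    rw [Subgroup.closure_le]
    rintro z ⟨-, hz⟩
    exact mem_CX.2 hz
  have hc := normal_central c hU hUx
  obtain ⟨A, hA, a, haA, ha1⟩ := c.exA
  have hAn : A.Normal := by
    apply normal_of_Nm
    intro g
    apply nm_of
    intro d hd
    have : d ∈ UU p x := Subgroup.subset_closure ⟨hA.2.1 d hd, mem_CX.1 (hA.1 hd)⟩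
    rw [(hc d this g).eq]
    simpa using hd
  have := c.nop A hAn hA.2.1
  rw [this, Subgroup.mem_bot] at haA
  exact ha1 haA

theorem Ctx.q1 (c : Ctx p q x) {g : G} (hg : g * x * g⁻¹ ∈ MM p x) {z : G} (hz : z ∈ MM p x) (hzp : PEl p z) :
    Commute (g * x * g⁻¹) z := by
  obtain ⟨N, K, h1, h2, h3, h4, h5, h6, h7⟩ := c.loc _ c.MM_ne g hg
  have hN := c.typeP h5 (CX_le_MM.trans h3)
  have := locComm c.hp c.hq c.hpq c.hp c.hpq.symm (c.reg.conj g) (c.hx.conj g) h6 h7 (h4 hz) hzp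
  rw [hN, Subgroup.mem_bot] at this
  exact commute_of_comm this

theorem Ctx.q2 (c : Ctx p q x) {g : G} (hg : g * x * g⁻¹ ∈ MM p x) : g ∈ MM p x := by
  rw [← inv_mem_iff]
  refine nm_closure ?_
  rintro z ⟨hz, hzx⟩
  refine ⟨hz.conj g⁻¹, ?_⟩
  have h := c.q1 hg (UU_le_MM (Subgroup.subset_closure ⟨hz, hzx⟩)) hz
  have h2 := h.map (MulAut.conj g⁻¹).toMonoidHom
  simpa [mul_assoc] using h2

theorem Ctx.q2' (c : Ctx p q x) {Q : Subgroup G} (hQ : PS q Q) (hx : x ∈ Q) : Q ≤ MM p x := by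
  by_contra h
  obtain ⟨y, hyQ, hyM, hyN⟩ := grow c.hq hQ (E := Q ⊓ MM p x) inf_le_left (fun h' => h (h'.trans inf_le_right))
  apply hyM
  refine ⟨hyQ, c.q2 ?_⟩
  exact (Nm.conj hyN (show x ∈ Q ⊓ MM p x from ⟨hx, CX_le_MM self_CX⟩)).2

theorem Ctx.fac (c : Ctx p q x) {H K : Subgroup G} (hHK : H ≤ Nm K) (hxK : x ∈ K) {h : G} (hh : h ∈ H) :
    ∃ k ∈ K, k⁻¹ * h ∈ MM p x := by
  have h1 : h * x * h⁻¹ ∈ K := Nm.conj (hHK hh) hxK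
  obtain ⟨S, hS, hS'⟩ := exMaxP (K := K) (D := Subgroup.zpowers x) (by simpa using hxK) c.hx.zpowers
  obtain ⟨T, hT, hT'⟩ := exMaxP (K := K) (D := Subgroup.zpowers (h * x * h⁻¹)) (by simpa using h1) (c.hx.conj h).zpowers
  obtain ⟨k, hk, hkT⟩ := hS.conj c.hq hT
  refine ⟨k, hk, c.q2 ?_⟩
  have h2 := (hkT _).1 (hT' (Subgroup.mem_zpowers _))
  have h3 := c.q2' hS.2.1 (hS' (Subgroup.mem_zpowers _)) h2
  simpa [mul_assoc] using h3

theorem Ctx.relIdx (c : Ctx p q x) {H : Subgroup G} (hH : H ≠ ⊤) (hxH : x ∈ H) {r : ℕ} (hr : r.Prime)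
    (hrp : r ≠ p) (hrq : r ≠ q) : ¬ r ∣ (MM p x).relIndex H := by
  obtain ⟨N, K, h1, h2, h3, h4, h5, h6, h7, -⟩ := c.locz hH hxH
  have hrel : (MM p x).relIndex K = (MM p x).relIndex H := by
    refine Nat.card_eq_of_bijective (Subgroup.quotientSubgroupOfEmbeddingOfLE (MM p x) h2)
      ⟨(Subgroup.quotientSubgroupOfEmbeddingOfLE (MM p x) h2).injective, ?_⟩
    intro y
    induction y using QuotientGroup.induction_on with
    | H y =>
    obtain ⟨k, hk, hkm⟩ := c.fac h4 h6 y.2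
    refine ⟨QuotientGroup.mk ⟨k, hk⟩, ?_⟩
    rw [Subgroup.quotientSubgroupOfEmbeddingOfLE_apply_mk, QuotientGroup.eq]
    exact hkm
  intro hd
  rw [← hrel] at hd
  have hd2 : r ∣ Nat.card K := hd.trans (Subgroup.relIndex_dvd_card _ _)
  haveI := Fact.mk hr
  obtain ⟨y, hy⟩ := exists_prime_orderOf_dvd_card' r hd2
  have hy1 : (y : G) ^ r = 1 := by
    have := pow_orderOf_eq_one y
    rw [hy] at this
    simpa using congrArg Subtype.val this
  obtain ⟨n, hn⟩ := h7 y y.2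
  have hyr : PEl r (y : G) := ⟨1, by simpa using hy1⟩
  have hyN := pel_mem_of_pow hr c.hq hrq hyr hn
  have := pel_coprime hr c.hp hrp hyr (h5 _ hyN)
  rw [OneMemClass.coe_eq_one] at this
  rw [this, orderOf_one] at hy
  exact hr.one_lt.ne hy

theorem MaxP.card {r : ℕ} (hr : r.Prime) {K S : Subgroup G} (hS : MaxP r K S) :
    Nat.card S = r ^ (Nat.card K).factorization r := by
  haveI := Fact.mk hr
  obtain ⟨P, hP⟩ := hS.exSylow
  have h := P.card_eq_multiplicity
  have h2 : Nat.card (P : Subgroup K) = Nat.card S := by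
    rw [hP]
    exact Nat.card_congr (Subgroup.subgroupOfEquivOfLe hS.1).toEquiv
  rw [← h2]
  exact h

theorem MaxP.card_le {r : ℕ} (hr : r.Prime) {K S : Subgroup G} (hS : MaxP r K S) {T : Subgroup G} (hT : PS r T)
    (hd : Nat.card T ∣ Nat.card K) : Nat.card T ≤ Nat.card S := by
  haveI := Fact.mk hr
  obtain ⟨n, hn⟩ := IsPGroup.iff_card.1 (ps_iff.1 hT)
  rw [hS.card hr, hn]
  rw [hn] at hd
  exact Nat.pow_le_pow_right hr.pos ((hr.pow_dvd_iff_le_factorization Nat.card_pos.ne').1 hd)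

theorem MaxP.not_dvd_index {r : ℕ} (hr : r.Prime) {S : Subgroup G} (hS : MaxP r ⊤ S) : ¬ r ∣ S.index := by
  intro hd
  have h1 := hS.card hr
  have h2 := S.card_mul_index
  rw [Subgroup.card_top] at h1
  have h3 : r ^ ((Nat.card G).factorization r + 1) ∣ Nat.card G := by
    rw [pow_succ, ← h1]
    conv_rhs => rw [← h2]
    exact mul_dvd_mul_left _ hd
  have := (hr.pow_dvd_iff_le_factorization Nat.card_pos.ne').1 h3
  omega

end


section
variable {G : Type u} [Group G] [Finite G]
variable {p q : ℕ} {x : G}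

theorem Ctx.idx (c : Ctx p q x) {r : ℕ} (hr : r.Prime) (hrp : r ≠ p) : ¬ r ∣ (MM p x).index := by
  obtain ⟨N, K, h1, h2, h3, h4, h5, h6, h7, h8⟩ := c.locz c.MM_ne (CX_le_MM self_CX)
  have hN := c.typeP h5 (CX_le_MM.trans h3)
  have hKq : PS q K := by
    intro k hk
    obtain ⟨n, hn⟩ := h7 k hk
    rw [hN, Subgroup.mem_bot] at hn
    exact ⟨n, hn⟩
  obtain ⟨Y, hY, -⟩ := exMaxP (K := MM p x) (p := r) (bot_le) ps_bot
  obtain ⟨P, hP, hYP⟩ := exMaxP (K := ⊤) le_top hY.2.1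
  by_cases hPY : P ≤ Y
  · intro hd
    exact hP.not_dvd_index hr (hd.trans (Subgroup.index_dvd_of_le (hPY.trans hY.1)))
  exfalso
  obtain ⟨y, hyP, hyY, hyN⟩ := grow hr hP.2.1 hYP hPY
  by_cases hrq : r = q
  · subst hrq
    have hKY : K ≤ Y := hY.le' hKq h2 (hY.1.trans h4)
    have hPM : P ≤ MM p x := c.q2' hP.2.1 (hYP (hKY h6))
    exact hPY (hY.2.2 P hPM hP.2.1 hYP)
  have hYx : Y ≤ CX x := by
    intro b hb
    have := h8 r hr (Ne.symm hrq) b (hY.1 hb) (hY.2.1 b hb)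
    rw [hN, Subgroup.mem_bot] at this
    exact mem_CX.2 (commute_of_comm this)
  have hY1P : Y ⊔ Subgroup.zpowers y ≤ P := sup_le hYP (by simpa using hyP)
  have hxH : x ∈ Subgroup.zpowers x ⊔ (Y ⊔ Subgroup.zpowers y) := Subgroup.mem_sup_left (Subgroup.mem_zpowers x)
  have hHN : Subgroup.zpowers x ⊔ (Y ⊔ Subgroup.zpowers y) ≤ Nm Y := by
    refine sup_le ?_ (sup_le le_Nm ?_)
    · simpa using nm_of_le_CX hYx
    · simpa using hyN
  by_cases hH : Subgroup.zpowers x ⊔ (Y ⊔ Subgroup.zpowers y) = ⊤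
  · rw [hH] at hHN
    have hYn : Y.Normal := normal_of_Nm (fun g => hHN trivial)
    have hcen := normal_central c hYn hYx
    have hW : (Subgroup.closure {x, y}).Normal := by
      have : (⊤ : Subgroup G) ≤ Nm (Subgroup.closure {x, y}) := by
        rw [← hH]
        refine sup_le ?_ (sup_le ?_ ?_)
        · simpa using le_Nm (Subgroup.subset_closure (by simp))
        · intro b hb
          apply nm_of
          intro d _
          rw [← (hcen b hb d).eq]
          simpa
        · simpa using le_Nm (Subgroup.subset_closure (by simp))
      exact normal_of_Nm (fun g => this trivial)
    have hWt := c.lemN hW (Subgroup.subset_closure (by simp))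
    obtain ⟨V, hV1, hV2, hV3, hV4, -⟩ := (c.reg y).sub c.hp
    rw [hWt] at hV1 hV3 hV4
    have hV := c.nop V (normal_of_Nm (fun g => hV3 trivial)) hV2
    apply c.endgame
    intro z hz
    have := hV4 z trivial hz
    rw [hV, Subgroup.mem_bot] at this
    rw [this]
    exact Commute.one_right x
  · have hrel := c.relIdx hH hxH hr hrp hrq
    set H := Subgroup.zpowers x ⊔ (Y ⊔ Subgroup.zpowers y) with hHd
    have hY1 : PS r (Y ⊔ Subgroup.zpowers y) := hP.2.1.mono hY1P
    have hd1 : Nat.card (Y ⊔ Subgroup.zpowers y : Subgroup G) ∣ Nat.card H := Subgroup.card_dvd_of_le le_sup_right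
    have hd2 : Nat.card H = Nat.card (MM p x ⊓ H : Subgroup G) * (MM p x).relIndex H := by
      have := ((MM p x).subgroupOf H).card_mul_index
      rw [← this]
      refine congrArg (fun t => t * ((MM p x).subgroupOf H).index) ?_
      rw [← Subgroup.inf_subgroupOf_right]
      exact Nat.card_congr (Subgroup.subgroupOfEquivOfLe inf_le_right).toEquiv
    haveI := Fact.mk hr
    obtain ⟨n, hn⟩ := IsPGroup.iff_card.1 (ps_iff.1 hY1)
    have hd3 : Nat.card (Y ⊔ Subgroup.zpowers y : Subgroup G) ∣ Nat.card (MM p x ⊓ H : Subgroup G) := by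
      rw [hd2] at hd1
      refine Nat.Coprime.dvd_of_dvd_mul_right ?_ hd1
      rw [hn]
      exact Nat.Coprime.pow_left n ((Nat.Prime.coprime_iff_not_dvd hr).2 hrel)
    have hle := hY.card_le hr hY1 (hd3.trans (Subgroup.card_dvd_of_le inf_le_left))
    have heq : Y = Y ⊔ Subgroup.zpowers y := Subgroup.eq_of_le_of_card_ge le_sup_left hle
    apply hyY
    rw [heq]
    exact Subgroup.mem_sup_right (Subgroup.mem_zpowers y)

theorem prod_of_coprime {M R : Subgroup G} (h : Nat.Coprime M.index R.index) (g : G) :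
    ∃ m ∈ M, ∃ r ∈ R, g = m * r := by
  have h1 : R.relIndex ⊤ = R.index := Subgroup.relIndex_top_right R
  have e1 : R.index ∣ R.relIndex M := by
    have h2 := Subgroup.relIndex_mul_index (inf_le_left : M ⊓ R ≤ M)
    have h3 := Subgroup.relIndex_mul_index (inf_le_right : M ⊓ R ≤ R)
    rw [Subgroup.inf_relIndex_left] at h2
    rw [Subgroup.inf_relIndex_right] at h3
    refine Nat.Coprime.dvd_of_dvd_mul_right h.symm ?_
    rw [h2, ← h3]
    exact Dvd.intro_left _ rfl
  have hpos : R.relIndex M ≠ 0 := Nat.card_pos.ne'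
  have e2 : R.index ≤ R.relIndex M := Nat.le_of_dvd (Nat.pos_of_ne_zero hpos) e1
  let f := Subgroup.quotientSubgroupOfEmbeddingOfLE R (le_top : M ≤ ⊤)
  have hf : Function.Surjective f := by
    apply (Nat.bijective_iff_injective_and_card f).2 ⟨f.injective, ?_⟩ |>.2
    apply le_antisymm (Nat.card_le_card_of_injective f f.injective)
    rw [← h1] at e2
    exact e2
  obtain ⟨y, hy⟩ := hf (QuotientGroup.mk ⟨g, trivial⟩)
  induction y using QuotientGroup.induction_on with
  | H y =>
  have h2 := hy
  simp only [f] at h2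
  rw [Subgroup.quotientSubgroupOfEmbeddingOfLE_apply_mk, QuotientGroup.eq] at h2
  exact ⟨y, y.2, (y : G)⁻¹ * g, h2, by group⟩

theorem Ctx.false (c : Ctx p q x) : False := by
  obtain ⟨A, hA, a, haA, ha1⟩ := c.exA
  have hAq : ∀ m ∈ MM p x, m * x * m⁻¹ ∈ Nm A := by
    intro m hm
    apply nm_of
    intro d hd
    have := c.q1 (mul_mem (mul_mem hm (CX_le_MM self_CX)) (inv_mem hm)) (CX_le_MM (hA.1 hd)) (hA.2.1 d hd)
    rw [this.eq, mul_inv_cancel_right]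
    exact hd
  obtain ⟨Y, -, ⟨hY, hAY, hYM⟩, hmax⟩ := exMax (fun Y => PS p Y ∧ A ≤ Y ∧ ∀ m ∈ MM p x, m * x * m⁻¹ ∈ Nm Y)
    ⟨hA.2.1, le_rfl, hAq⟩
  have hYne : Y ≠ ⊥ := fun h => ha1 (by simpa [h] using hAY haA)
  have hxY : x ∈ Nm Y := by simpa using hYM 1 (one_mem _)
  obtain ⟨N, K, h1, h2, h3, h4, h5, h6, h7, h8⟩ := c.locz (nm_ne_top c hY hYne) hxY
  have hNY : N ≤ Y := le_sup_left.trans (hmax (N ⊔ Y) ⟨ps_sup h5 hY (h1.trans h2), hAY.trans le_sup_right,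
    fun m hm => nm_sup (h3 (hYM m hm)) (hYM m hm)⟩ le_sup_right)
  obtain ⟨R, hR, hYR, hxR⟩ := c.sylX hY hxY
  have hRY : R ≤ Y := by
    by_contra hcon
    obtain ⟨n, hnR, hnY, hnN⟩ := grow c.hp hR.2.1 hYR hcon
    obtain ⟨d, hd, j, hj, e⟩ := copN c.hp c.hq c.hpq c.hx h5 (h3 hxY)
      (h8 p c.hp c.hpq.symm n⁻¹ (inv_mem hnN) (hR.2.1 n hnR).inv)
    apply hnY
    rw [e]
    refine mul_mem (hAY (hA.inter hR.2.1 (hAY.trans hYR) ?_ hd)) (hNY hj)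
    have : d = n * j⁻¹ := by rw [e]; group
    rw [this]
    exact mul_mem hnR (inv_mem (hYR (hNY hj)))
  have hYe : Y = R := le_antisymm hYR hRY
  subst hYe
  have hcop : Nat.Coprime (MM p x).index Y.index := by
    rw [Nat.coprime_iff_gcd_eq_one]
    by_contra hne
    obtain ⟨r, hr, hd⟩ := Nat.exists_prime_and_dvd hne
    by_cases hrp : r = p
    · subst hrp
      exact hR.not_dvd_index hr (hd.trans (Nat.gcd_dvd_right _ _))
    · exact c.idx hr hrp (hd.trans (Nat.gcd_dvd_left _ _))
  have hall : ∀ g, g * x * g⁻¹ ∈ Nm Y := by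
    intro g
    obtain ⟨m, hm, r, hr, e⟩ := prod_of_coprime hcop g⁻¹
    have hg : g = r⁻¹ * m⁻¹ := by rw [← inv_inv g, e]; group
    have h := mul_mem (mul_mem (inv_mem (le_Nm hr)) (hYM m⁻¹ (inv_mem hm))) (le_Nm hr)
    rw [hg]
    simpa [mul_assoc] using h
  have hallP : ∀ P, MaxP p ⊤ P → ∀ g, g * x * g⁻¹ ∈ Nm P := by
    intro P hP g
    obtain ⟨k, -, hk⟩ := hR.conj c.hp hP
    apply nm_of
    intro d hd
    rw [hk] at hd ⊢
    have := Nm.conj (hall (k⁻¹ * g)) hd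
    simpa [mul_assoc] using this
  apply c.endgame
  intro z hz
  apply commute_of_comm
  have hk := c.reg.comm c.hp c.hq c.hp c.hpq.symm c.hx hz
  obtain ⟨L, hL1, hL2, hL3⟩ := core (p := p) (x * z * x⁻¹ * z⁻¹) (fun P hP => hP.mem hk trivial (by
    have e1 := hallP P hP 1
    have e2 := inv_mem (hallP P hP z)
    have := mul_mem e1 e2
    simpa [mul_assoc] using this))
  rw [c.nop L hL1 hL2, Subgroup.mem_bot] at hL3
  exact hL3

end

theorem main_loc {G : Type u} [Group G] [Finite G] {p q : ℕ} (hp : p.Prime) (hq : q.Prime) (hpq : p ≠ q) {x : G}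
    (hx : PEl q x) (hreg : Reg p x) : Loc p q ⊤ x :=
  main_of_ctx hp hq hpq (fun _ _ _ _ c => c.false) _ G x rfl hx hreg


section
variable {G : Type u} [Group G] [Finite G]
variable {p q : ℕ} {x : G}

theorem gen {K T : Subgroup G} (h : ∀ r : ℕ, r.Prime → ∀ z ∈ K, PEl r z → z ∈ T) : K ≤ T := by
  have hd : Nat.card K ∣ Nat.card (K ⊓ T : Subgroup G) := by
    rw [Nat.dvd_iff_prime_pow_dvd_dvd]
    intro r k hr hk
    obtain ⟨S, hS, -⟩ := exMaxP (K := K) (p := r) bot_le ps_bot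
    have h1 : S ≤ K ⊓ T := le_inf hS.1 (fun z hz => h r hr z (hS.1 hz) (hS.2.1 z hz))
    refine dvd_trans ?_ (Subgroup.card_dvd_of_le h1)
    rw [hS.card hr]
    exact pow_dvd_pow r ((hr.pow_dvd_iff_le_factorization Nat.card_pos.ne').1 hk)
  have := Subgroup.eq_of_le_of_card_ge (inf_le_left : K ⊓ T ≤ K) (Nat.le_of_dvd Nat.card_pos hd)
  rw [← this]
  exact inf_le_right

theorem nil_of_gen (S : ℕ → Subgroup G) (hn : ∀ r, r.Prime → (S r).Normal) (hS : ∀ r, r.Prime → PS r (S r))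
    (hg : ∀ T : Subgroup G, (∀ r, r.Prime → S r ≤ T) → T = ⊤) : Group.IsNilpotent G := by
  classical
  let ι := {r // r ∈ (Nat.card G).primeFactors}
  have hpr : ∀ i : ι, (i : ℕ).Prime := fun i => Nat.prime_of_mem_primeFactors i.2
  let F : ι → Subgroup G := fun i => S i
  have hcomm : Pairwise fun i j : ι => ∀ a b : G, a ∈ F i → b ∈ F j → Commute a b := by
    intro i j hij
    apply Subgroup.commute_of_normal_of_disjoint _ _ (hn _ (hpr i)) (hn _ (hpr j))
    rw [Subgroup.disjoint_def]
    intro z hz1 hz2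
    exact pel_coprime (hpr i) (hpr j) (fun h => hij (Subtype.ext h)) (hS _ (hpr i) z hz1) (hS _ (hpr j) z hz2)
  have : ∀ i, Group.IsNilpotent (F i) := fun i => by
    haveI := Fact.mk (hpr i)
    exact IsPGroup.isNilpotent (ps_iff.1 (hS _ (hpr i)))
  have hr : (Subgroup.noncommPiCoprod hcomm).range = ⊤ := by
    rw [Subgroup.noncommPiCoprod_range]
    apply hg
    intro r hr z hz
    by_cases hd : r ∣ Nat.card G
    · exact le_iSup F ⟨r, Nat.mem_primeFactors.2 ⟨hr, hd, Nat.card_pos.ne'⟩⟩ hz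
    · obtain ⟨n, hn⟩ := hS r hr z hz
      have hc : Nat.Coprime (r ^ n) (Nat.card G) :=
        Nat.Coprime.pow_left n ((Nat.Prime.coprime_iff_not_dvd hr).2 hd)
      have h1 : orderOf z ∣ 1 := hc ▸ Nat.dvd_gcd (orderOf_dvd_of_pow_eq_one hn) (orderOf_dvd_natCard z)
      have : z = 1 := orderOf_eq_one_iff.1 (Nat.dvd_one.1 h1)
      rw [this]
      exact one_mem _
  exact Group.nilpotent_of_surjective _ (MonoidHom.range_eq_top.1 hr)

/-- nilpotent times a normal `q`-group centralized by the `q'`-elements -/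
theorem nil_ext {H K : Subgroup G} (hq : q.Prime) (hH : Group.IsNilpotent H) (hK : K.Normal) (hKq : PS q K)
    (hHK : H ⊔ K = ⊤)
    (hc : ∀ r : ℕ, r.Prime → q ≠ r → ∀ b ∈ H, PEl r b → ∀ k ∈ K, Commute k b) : Group.IsNilpotent G := by
  have hex : ∀ r : ℕ, ∃ S : Subgroup G, r.Prime → (S ≤ H ∧ PS r S ∧ H ≤ Nm S ∧ ∀ z ∈ H, PEl r z → z ∈ S) := by
    intro r
    by_cases hr : r.Prime
    · obtain ⟨Q, h1, h2, h3⟩ := nilp_sylow (X := H) hr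
      refine ⟨Q.map H.subtype, fun _ => ⟨Subgroup.map_subtype_le Q, ps_iff.2 ((ps_iff.1 h2).map _), ?_, ?_⟩⟩
      · intro a ha
        apply nm_of
        rintro _ ⟨d, hd, rfl⟩
        exact ⟨⟨a, ha⟩ * d * ⟨a, ha⟩⁻¹, h1.conj_mem _ hd _, rfl⟩
      · rintro z hz ⟨n, hn⟩
        exact ⟨⟨z, hz⟩, h3 _ ⟨n, by ext; simpa using hn⟩, rfl⟩
    · exact ⟨⊥, fun h => absurd h hr⟩
  choose S hS using hex
  have hKN : ∀ D : Subgroup G, D ≤ Nm K := fun D => Subgroup.le_normalizer_of_normal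
  refine nil_of_gen (fun r => if r = q then S r ⊔ K else S r) ?_ ?_ ?_
  · intro r hr
    obtain ⟨h1, h2, h3, h4⟩ := hS r hr
    have : (⊤ : Subgroup G) ≤ Nm (if r = q then S r ⊔ K else S r) := by
      rw [← hHK]
      split_ifs with h
      · exact sup_le (fun a ha => nm_sup (h3 ha) (hKN ⊤ trivial)) (le_sup_right.trans le_Nm)
      · refine sup_le h3 (fun k hk => ?_)
        apply nm_of
        intro d hd
        rw [(hc r hr (Ne.symm h) d (h1 hd) (h2 d hd) k hk).eq, mul_inv_cancel_right]
        exact hd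
    exact normal_of_Nm (fun g => this trivial)
  · intro r hr
    obtain ⟨h1, h2, h3, h4⟩ := hS r hr
    split_ifs with h
    · subst h
      exact ps_sup h2 hKq (hKN _)
    · exact h2
  · intro T hT
    have hKT : K ≤ T := by
      have := hT q hq
      rw [if_pos rfl] at this
      exact le_sup_right.trans this
    rw [eq_top_iff, ← hHK]
    refine sup_le (gen fun r hr z hz hzr => ?_) hKT
    have h5 := (hS r hr).2.2.2 z hz hzr
    have := hT r hr
    split_ifs at this
    · exact this (Subgroup.mem_sup_left h5)
    · exact this h5

theorem ff_ext {H K N : Subgroup G} (hp : p.Prime) (hq : q.Prime) (hpq : p ≠ q) (hH : FF p H) (hK : K.Normal)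
    (hN : N.Normal) (hNp : PS p N) (hKN : ∀ k ∈ K, ∃ n : ℕ, k ^ q ^ n ∈ N) (hHK : H ⊔ K = ⊤)
    (hc : ∀ r : ℕ, r.Prime → q ≠ r → ∀ b ∈ H, PEl r b → ∀ k ∈ K, k * b * k⁻¹ * b⁻¹ ∈ N) : FF p G := by
  obtain ⟨V, hV, hVp, hVn, -, -⟩ := hH.struct hp
  have hV'p : PS p (V.map H.subtype) := ps_iff.2 ((ps_iff.1 hVp).map _)
  have hPp : PS p (V.map H.subtype ⊔ N) := ps_sup hV'p hNp Subgroup.le_normalizer_of_normal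
  have hPn : (V.map H.subtype ⊔ N).Normal := by
    have hNt : (⊤ : Subgroup G) ≤ Nm N := Subgroup.le_normalizer_of_normal
    have : (⊤ : Subgroup G) ≤ Nm (V.map H.subtype ⊔ N) := by
      rw [← hHK]
      refine sup_le (fun a ha => nm_sup ?_ (hNt trivial)) (fun k hk => ?_)
      · apply nm_of
        rintro _ ⟨d, hd, rfl⟩
        exact ⟨⟨a, ha⟩ * d * ⟨a, ha⟩⁻¹, hV.conj_mem _ hd _, rfl⟩
      · apply nm_of
        intro d hd
        obtain ⟨v, hv, n, hn, rfl⟩ := (mem_sup_nm (fun _ _ => hNt trivial)).1 hd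
        have h1 := hc p hp hpq.symm v (Subgroup.map_subtype_le V hv) (hV'p v hv) k hk
        have h2 := mul_mem (mul_mem (Subgroup.mem_sup_right (S := V.map H.subtype) h1) (Subgroup.mem_sup_left (T := N) hv))
          (Subgroup.mem_sup_right (S := V.map H.subtype) (hN.conj_mem n hn k))
        have e : k * v * k⁻¹ * v⁻¹ * v * (k * n * k⁻¹) = k * (v * n) * k⁻¹ := by group
        rwa [e] at h2
    exact normal_of_Nm (fun g => this trivial)
  refine ⟨V.map H.subtype ⊔ N, hPn, ps_iff.1 hPp, ?_⟩
  generalize hPd : V.map H.subtype ⊔ N = P at hPp hPn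
  have hVP : V.map H.subtype ≤ P := hPd ▸ le_sup_left
  have hNP : N ≤ P := hPd ▸ le_sup_right
  set π := QuotientGroup.mk' P with hπ
  have hker : ∀ z ∈ P, π z = 1 := fun z hz => (QuotientGroup.eq_one_iff z).2 hz
  let f : H ⧸ V →* G ⧸ P := QuotientGroup.lift V (π.comp H.subtype) (fun v hv => hker _ (hVP ⟨v, hv, rfl⟩))
  have hf : f.range = H.map π := by
    ext z
    constructor
    · rintro ⟨y, rfl⟩
      induction y using QuotientGroup.induction_on with
      | H y => exact ⟨y, y.2, rfl⟩
    · rintro ⟨y, hy, rfl⟩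
      exact ⟨QuotientGroup.mk ⟨y, hy⟩, rfl⟩
  have hnil : Group.IsNilpotent (H.map π) := by
    rw [← hf]
    exact Group.nilpotent_of_surjective f.rangeRestrict f.rangeRestrict_surjective
  have hπs : Function.Surjective π := QuotientGroup.mk'_surjective P
  refine nil_ext (q := q) (H := H.map π) (K := K.map π) hq hnil (hK.map π hπs) ?_ ?_ ?_
  · rintro _ ⟨k, hk, rfl⟩
    obtain ⟨n, hn⟩ := hKN k hk
    exact ⟨n, by rw [← map_pow]; exact hker _ (hNP hn)⟩
  · rw [← Subgroup.map_sup, hHK, Subgroup.map_top_of_surjective π hπs]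
  · rintro r hr hqr b hb hbr _ ⟨k, hk, rfl⟩
    have hle : ∀ t : G, t ∈ H → PEl r (π t) → Commute (π k) (π t) := by
      intro t ht htr
      have hz : Subgroup.zpowers t ≤ (Subgroup.centralizer {π k}).comap π := by
        apply gen
        intro s hs z hz hzs
        rw [Subgroup.mem_comap]
        refine mem_CX.2 ?_
        by_cases hsq : q = s
        · subst hsq
          obtain ⟨i, rfl⟩ := hz
          have h1 : PEl r (π (t ^ i)) := by
            rw [map_zpow]
            exact htr.zpowers _ ⟨i, rfl⟩
          have h2 : PEl q (π (t ^ i)) := hzs.map π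
          have h3 := pel_coprime hq hr hqr h2 h1
          simp only at h3 ⊢
          rw [h3]
          exact Commute.one_right _
        · have h1 := hker _ (hNP (hc s hs hsq z (Subgroup.zpowers_le.2 ht hz) hzs k hk))
          rw [map_mul, map_mul, map_mul, map_inv, map_inv] at h1
          exact commute_of_comm h1
      exact mem_CX.1 (hz (Subgroup.mem_zpowers t))
    obtain ⟨t, ht, rfl⟩ := hb
    exact hle t ht hbr


theorem ff_sup {H K N : Subgroup G} (hp : p.Prime) (hq : q.Prime) (hpq : p ≠ q) (hH : FF p H) (hK : K.Normal)
    (hN : N.Normal) (hNK : N ≤ K) (hNp : PS p N) (hKN : ∀ k ∈ K, ∃ n : ℕ, k ^ q ^ n ∈ N)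
    (hc : ∀ r : ℕ, r.Prime → q ≠ r → ∀ b ∈ H, PEl r b → ∀ k ∈ K, k * b * k⁻¹ * b⁻¹ ∈ N) :
    FF p (H ⊔ K : Subgroup G) := by
  generalize hL : H ⊔ K = L
  have hHL : H ≤ L := hL ▸ le_sup_left
  have hKL : K ≤ L := hL ▸ le_sup_right
  have hFH : FF p (H.subgroupOf L) :=
    hH.of_injective (Subgroup.subgroupOfEquivOfLe hHL).toMonoidHom (Subgroup.subgroupOfEquivOfLe hHL).injective
  refine ff_ext (H := H.subgroupOf L) (K := K.subgroupOf L) (N := N.subgroupOf L) hp hq hpq hFH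
    (hK.subgroupOf L) (hN.subgroupOf L) ?_ ?_ ?_ ?_
  · intro z hz
    obtain ⟨n, hn⟩ := hNp _ hz
    exact ⟨n, by ext; simpa using hn⟩
  · intro k hk
    obtain ⟨n, hn⟩ := hKN _ hk
    exact ⟨n, hn⟩
  · rw [← Subgroup.subgroupOf_sup hHL hKL, hL, Subgroup.subgroupOf_self]
  · intro r hr hqr b hb hbr k hk
    exact hc r hr hqr _ hb (hbr.map L.subtype) _ hk

theorem main_p (hp : p.Prime) (hx : PEl p x) (hreg : Reg p x) {H : Subgroup G} (hH : FF p H)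
    (hmax : ∀ K : Subgroup G, FF p K → H ≤ K → K = H) : x ∈ H := by
  have key : ∀ g, PS p (Subgroup.closure {x, g * x * g⁻¹}) := by
    intro g
    obtain ⟨V, h1, h2, h3, h4, -⟩ := (hreg (g * x * g⁻¹)).sub hp
    refine h2.mono ?_
    rw [Subgroup.closure_le]
    rintro s (rfl | rfl)
    · exact h4 _ (Subgroup.subset_closure (by simp)) hx
    · exact h4 _ (Subgroup.subset_closure (by simp)) (hx.conj g)
  obtain ⟨N, hN, hNp, hxN⟩ := bsN hp x key
  obtain ⟨q, hq1, hq⟩ := Nat.exists_infinite_primes (p + 1)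
  have hF : FF p (H ⊔ N : Subgroup G) := by
    refine ff_sup (q := q) (N := N) hp hq (by omega) hH hN hN le_rfl hNp (fun k hk => ⟨0, by simpa using hk⟩) ?_
    intro r _ _ b _ _ k hk
    have := mul_mem hk (hN.conj_mem _ (inv_mem hk) b)
    simpa [mul_assoc] using this
  rw [← hmax _ hF le_sup_left]
  exact Subgroup.mem_sup_right hxN

theorem main_q (hp : p.Prime) (hq : q.Prime) (hpq : p ≠ q) (hx : PEl q x) (hreg : Reg p x) {H : Subgroup G}
    (hH : FF p H) (hmax : ∀ K : Subgroup G, FF p K → H ≤ K → K = H) : x ∈ H := by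
  obtain ⟨N, K, h1, -, h3, h4, h5, h6, h7⟩ := main_loc hp hq hpq hx hreg
  have hN : N.Normal := normal_of_Nm (fun g => h3 trivial)
  have hK : K.Normal := normal_of_Nm (fun g => h4 trivial)
  have hle : Subgroup.normalClosure {x} ≤ K := Subgroup.normalClosure_le_normal (by simpa using h6)
  have hF : FF p (H ⊔ (Subgroup.normalClosure {x} ⊔ N) : Subgroup G) := by
    refine ff_sup (q := q) (N := N) hp hq hpq hH inferInstance hN le_sup_right h5
      (fun k hk => h7 k (sup_le hle h1 hk)) ?_
    intro r hr hqr b _ hb k hk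
    have hT : Subgroup.normalClosure {x} ⊔ N ≤
        (CX (QuotientGroup.mk' N b)).comap (QuotientGroup.mk' N) := by
      refine sup_le ?_ ?_
      · unfold Subgroup.normalClosure
        rw [Subgroup.closure_le]
        intro y hy
        obtain ⟨a, ha, hy2⟩ := Group.mem_conjugatesOfSet_iff.1 hy
        rw [Set.mem_singleton_iff] at ha
        subst ha
        obtain ⟨g, rfl⟩ := isConj_iff.1 hy2
        have e := locComm hp hq hpq hr hqr (hreg.conj g) (hx.conj g) (hK.conj_mem _ h6 g) h7 (h4 (Subgroup.mem_top b)) hb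
        have e2 : QuotientGroup.mk' N _ = 1 := (QuotientGroup.eq_one_iff _).2 e
        rw [map_mul, map_mul _ _ (_⁻¹), map_mul _ _ b, map_inv, map_inv] at e2
        exact mem_CX.2 (commute_of_comm e2).symm
      · intro n hn
        have e2 : QuotientGroup.mk' N n = 1 := (QuotientGroup.eq_one_iff _).2 hn
        rw [Subgroup.mem_comap, e2]
        exact one_mem _
    have h8 := (mem_CX.1 (hT hk)).symm
    rw [← QuotientGroup.eq_one_iff]
    change QuotientGroup.mk' N _ = 1
    rw [map_mul, map_mul, map_mul, map_inv, map_inv, h8.eq]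
    group
  rw [← hmax _ hF le_sup_left]
  exact Subgroup.mem_sup_right (Subgroup.mem_sup_left (Subgroup.subset_normalClosure rfl))

theorem ff_zpowers (y : G) : FF p (Subgroup.zpowers y) := by
  refine ⟨⊥, inferInstance, IsPGroup.of_bot, ?_⟩
  haveI : Group.IsNilpotent (Subgroup.zpowers y) :=
    @CommGroup.isNilpotent _ { (inferInstance : Group (Subgroup.zpowers y)) with mul_comm := fun a b => (Subgroup.zpowers_isMulCommutative y).is_comm.comm a b }
  exact Group.nilpotent_of_surjective (QuotientGroup.mk' _) (QuotientGroup.mk'_surjective _)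

end

theorem SpN_regular (p : ℕ) (hp : p.Prime) (G : Type u) [Group G] [Finite G] :
    {x : G | ∀ y : G, SpNt p 1 ↥(Subgroup.closure {x, y})} =
      ↑(sInf {H : Subgroup G |
        SpNt p 1 ↥H ∧ ∀ K : Subgroup G, SpNt p 1 ↥K → H ≤ K → K = H}) := by
  simp only [spnt_iff]
  ext x
  rw [SetLike.mem_coe, Subgroup.mem_sInf]
  constructor
  · rintro hx H ⟨hH, hmax⟩
    have hreg : Reg p x := hx
    have hle : Subgroup.zpowers x ≤ H := by
      apply gen
      intro r hr z hz hzr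
      by_cases hpr : p = r
      · subst hpr
        exact main_p hp hzr (hreg.mem hz) hH hmax
      · exact main_q hp hr hpr hzr (hreg.mem hz) hH hmax
    exact hle (Subgroup.mem_zpowers x)
  · intro h y
    obtain ⟨S, h1, h2, h3⟩ := exMax (fun S : Subgroup G => FF p S) (ff_zpowers y)
    have hxS := h S ⟨h2, fun K hK hle => le_antisymm (h3 K hK hle) hle⟩
    refine h2.mono ?_
    rw [Subgroup.closure_le]
    rintro s (rfl | rfl)
    · exact hxS
    · exact h1 (Subgroup.mem_zpowers _)
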